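/- arXiv:1911.02146 — 2 statements merged into one kernel-verified Lean document; each statement's English description precedes it below -/
import Mathlib

section
/- Let H > 0, ε > 0, and let D = ×_{j=1}^n D_j and D' = ×_{j=1}^n D'_j be product distributions on (−∞,H]^n that differ only in a single coordinate i (i.e., D_j = D'_j for all j ≠ i) and satisfy ‖D_i − D'_i‖_K ≤ ε. Then OPT(D') ≥ OPT(D) − 3H·ε. -/
open MeasureTheory Set

namespace SingleItem

/-- A single-item mechanism for `n` bidders: (expected) allocation probabilities and
(expected) payments on each bid profile. -/
structure Mech (n : ℕ) where
  alloc : (Fin n → ℝ) → Fin n → ℝ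
  pay : (Fin n → ℝ) → Fin n → ℝ
  alloc_nonneg : ∀ b i, 0 ≤ alloc b i
  alloc_sum_le_one : ∀ b, ∑ i, alloc b i ≤ 1
  meas_alloc : ∀ i, Measurable fun b => alloc b i
  meas_pay : ∀ i, Measurable fun b => pay b i

/-- Utility of bidder `i` with value `vi` when the bid profile is `b`. -/
def util {n : ℕ} (M : Mech n) (i : Fin n) (vi : ℝ) (b : Fin n → ℝ) : ℝ :=
  vi * M.alloc b i - M.pay b i

/-- Dominant-strategy incentive compatibility. -/
def DSIC {n : ℕ} (M : Mech n) : Prop :=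
  ∀ (i : Fin n) (v : Fin n → ℝ) (v' : ℝ),
    util M i (v i) (Function.update v i v') ≤ util M i (v i) v

/-- (Ex-post) individual rationality. -/
def IR {n : ℕ} (M : Mech n) : Prop :=
  ∀ (i : Fin n) (v : Fin n → ℝ), 0 ≤ util M i (v i) v

/-- Expected revenue of a mechanism under (truthful) bids drawn from `D`. -/
noncomputable def Rev {n : ℕ} (M : Mech n) (D : Measure (Fin n → ℝ)) : ℝ :=
  ∫ b, (∑ i, M.pay b i) ∂D

/-- Optimal revenue over DSIC and IR mechanisms. -/
noncomputable def OPT {n : ℕ} (D : Measure (Fin n → ℝ)) : ℝ :=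
  sSup {r | ∃ M : Mech n, DSIC M ∧ IR M ∧ r = Rev M D}

/-- The Lévy distance between `P` and `Q` is at most `ε`. -/
def LevyLe (P Q : Measure ℝ) (ε : ℝ) : Prop :=
  ∀ x : ℝ, (P (Iic (x - ε))).toReal - ε ≤ (Q (Iic x)).toReal ∧
    (Q (Iic x)).toReal ≤ (P (Iic (x + ε))).toReal + ε

/-- The Kolmogorov distance between `P` and `Q` is at most `ε`. -/
def KolmogorovLe (P Q : Measure ℝ) (ε : ℝ) : Prop :=
  ∀ x : ℝ, |(P (Iic x)).toReal - (Q (Iic x)).toReal| ≤ ε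

end SingleItem

namespace SingleItem
open Function

lemma mono_int {z : ℝ → ℝ} (hz : Monotone z) (a b : ℝ) : ∫ s in a..b, z s ≤ (b - a) * z b := by
  rcases le_total a b with h | h
  · have : ∫ s in a..b, z s ≤ ∫ s in a..b, z b :=
      intervalIntegral.integral_mono_on h hz.intervalIntegrable (by simp) (fun s hs => hz hs.2)
    simpa using this
  · have : ∫ s in b..a, z b ≤ ∫ s in b..a, z s :=
      intervalIntegral.integral_mono_on h (by simp) hz.intervalIntegrable (fun s hs => hz hs.1)
    rw [intervalIntegral.integral_symm]
    simp at this
    linarith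

lemma sub_int {u z : ℝ → ℝ} (hz : Monotone z) (h : ∀ a b, u a + (b - a) * z a ≤ u b) {a b : ℝ}
    (hab : a ≤ b) : ∫ s in a..b, z s = u b - u a := by
  have hd : ∀ t, ContinuousAt z t → HasDerivAt u (z t) t := by
    intro t ht
    rw [hasDerivAt_iff_isLittleO, Asymptotics.isLittleO_iff]
    intro c hc
    have := Metric.continuousAt_iff'.1 ht c hc
    filter_upwards [this] with s hs
    rw [Real.dist_eq] at hs
    have h1 := h t s
    have h2 := h s t
    rw [Real.norm_eq_abs, Real.norm_eq_abs, smul_eq_mul]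
    have h3 : 0 ≤ u s - u t - (s - t) * z t := by linarith
    rw [abs_of_nonneg h3]
    calc _ ≤ (z s - z t) * (s - t) := by linarith
      _ ≤ |(z s - z t) * (s - t)| := le_abs_self _
      _ = |z s - z t| * |s - t| := abs_mul _ _
      _ ≤ _ := by gcongr
  have hcont : ContinuousOn u (uIcc a b) := by
    rw [uIcc_of_le hab]
    have hL : LipschitzOnWith (Real.toNNReal (|z a| + |z b|)) u (Icc a b) := by
      apply LipschitzOnWith.of_dist_le_mul
      intro s hs t ht
      rw [Real.dist_eq, Real.dist_eq, Real.coe_toNNReal _ (by positivity)]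
      have h1 := h t s
      have h2 := h s t
      have bd : ∀ r ∈ Icc a b, |z r| ≤ |z a| + |z b| := by
        intro r hr
        have := hz hr.1
        have := hz hr.2
        rw [abs_le]
        constructor
        · linarith [neg_abs_le (z a), abs_nonneg (z b)]
        · linarith [le_abs_self (z b), abs_nonneg (z a)]
      have k1 : |(s - t) * z s| ≤ (|z a| + |z b|) * |s - t| := by
        rw [abs_mul, mul_comm]; gcongr; exact bd s hs
      have k2 : |(s - t) * z t| ≤ (|z a| + |z b|) * |s - t| := by
        rw [abs_mul, mul_comm]; gcongr; exact bd t ht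
      rw [abs_le] at k1 k2 ⊢
      constructor <;> linarith [k1.1, k1.2, k2.1, k2.2]
    exact hL.continuousOn
  refine MeasureTheory.integral_eq_of_hasDerivAt_off_countable u z
    hz.countable_not_continuousAt hcont ?_ hz.intervalIntegrable
  intro t ht
  exact hd t (by simpa using ht.2)

structure IsAlloc {n : ℕ} (x : (Fin n → ℝ) → Fin n → ℝ) : Prop where
  nonneg : ∀ b i, 0 ≤ x b i
  sum_le : ∀ b, ∑ i, x b i ≤ 1
  meas : ∀ i, Measurable fun b => x b i
  mono : ∀ j v, Monotone fun a => x (update v j a) j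

noncomputable def mpay {n : ℕ} (x : (Fin n → ℝ) → Fin n → ℝ) (v : Fin n → ℝ) (j : Fin n) : ℝ :=
  max (v j) 0 * x v j - ∫ s in (0:ℝ)..max (v j) 0, x (update v j s) j

lemma meas_mpay {n : ℕ} {x : (Fin n → ℝ) → Fin n → ℝ} (hx : IsAlloc x) (j : Fin n) :
    Measurable fun v => mpay x v j := by
  have hm := hx.meas j
  have h1 : ∀ v : Fin n → ℝ, ∫ s in (0:ℝ)..max (v j) 0, x (update v j s) j
      = max (v j) 0 * ∫ s in Ioc (0:ℝ) 1, x (update v j (max (v j) 0 * s)) j := by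
    intro v
    rw [← intervalIntegral.integral_of_le zero_le_one,
      intervalIntegral.mul_integral_comp_mul_left (f := fun s => x (update v j s) j)]
    simp
  unfold mpay
  simp_rw [h1]
  have hmax : Measurable fun v : Fin n → ℝ => max (v j) 0 := by fun_prop
  refine (hmax.mul hm).sub (hmax.mul ?_)
  have : Measurable fun q : (Fin n → ℝ) × ℝ => x (update q.1 j (max (q.1 j) 0 * q.2)) j := by
    apply hm.comp
    rw [measurable_pi_iff]
    intro k
    by_cases hk : k = j
    · subst hk; simp only [update_self]; fun_prop
    · simp only [update_of_ne hk]; fun_prop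
  exact this.stronglyMeasurable.integral_prod_right'.measurable

noncomputable def mye {n : ℕ} (x : (Fin n → ℝ) → Fin n → ℝ) (hx : IsAlloc x) : Mech n where
  alloc v j := if 0 ≤ v j then x v j else 0
  pay := mpay x
  alloc_nonneg b i := by split_ifs; exacts [hx.nonneg b i, le_rfl]
  alloc_sum_le_one b := by
    refine le_trans (Finset.sum_le_sum fun i _ => ?_) (hx.sum_le b)
    split_ifs; exacts [le_rfl, hx.nonneg b i]
  meas_alloc i := by
    exact Measurable.ite (measurableSet_le measurable_const (measurable_pi_apply i)) (hx.meas i)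
      measurable_const
  meas_pay := meas_mpay hx

lemma util_mye {n : ℕ} {x : (Fin n → ℝ) → Fin n → ℝ} (hx : IsAlloc x) (i : Fin n) (v : Fin n → ℝ) :
    util (mye x hx) i (v i) v = ∫ s in (0:ℝ)..max (v i) 0, x (update v i s) i := by
  simp only [util, mye, mpay]
  split_ifs with h
  · rw [max_eq_left h]; ring
  · rw [max_eq_right (by linarith)]; simp

lemma int_nonneg {n : ℕ} {x : (Fin n → ℝ) → Fin n → ℝ} (hx : IsAlloc x) (i : Fin n)
    (v : Fin n → ℝ) : 0 ≤ ∫ s in (0:ℝ)..max (v i) 0, x (update v i s) i :=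
  intervalIntegral.integral_nonneg (le_max_right _ _) fun _ _ => hx.nonneg _ _

lemma mye_IR {n : ℕ} {x : (Fin n → ℝ) → Fin n → ℝ} (hx : IsAlloc x) : IR (mye x hx) := by
  intro i v
  rw [util_mye]
  exact int_nonneg hx i v

lemma mye_DSIC {n : ℕ} {x : (Fin n → ℝ) → Fin n → ℝ} (hx : IsAlloc x) : DSIC (mye x hx) := by
  intro i v b
  rw [util_mye]
  simp only [util, mye, mpay, update_self, update_idem]
  split_ifs with h
  · rw [max_eq_left h]
    have h1 := mono_int (hx.mono i v) (max (v i) 0) b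
    have h2 := intervalIntegral.integral_add_adjacent_intervals (μ := volume)
      (hx.mono i v).intervalIntegrable (hx.mono i v).intervalIntegrable (a := 0)
      (b := max (v i) 0) (c := b)
    have h3 : v i * x (update v i b) i ≤ max (v i) 0 * x (update v i b) i :=
      mul_le_mul_of_nonneg_right (le_max_left _ _) (hx.nonneg _ _)
    linarith
  · rw [max_eq_right (by linarith : b ≤ 0)]
    simpa using int_nonneg hx i v

lemma mpay_nonneg {n : ℕ} {x : (Fin n → ℝ) → Fin n → ℝ} (hx : IsAlloc x) (i : Fin n)
    (v : Fin n → ℝ) : 0 ≤ mpay x v i := by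
  unfold mpay
  rcases le_total (v i) 0 with h | h
  · rw [max_eq_right h]; simp
  · rw [max_eq_left h]
    have := mono_int (hx.mono i v) 0 (v i)
    simp at this
    linarith

lemma mpay_sum_le {n : ℕ} {x : (Fin n → ℝ) → Fin n → ℝ} (hx : IsAlloc x) {H : ℝ} (hH : 0 < H)
    {v : Fin n → ℝ} (hv : ∀ j, v j ≤ H) : ∑ i, mpay x v i ≤ H := by
  calc _ ≤ ∑ i, H * x v i := by
        refine Finset.sum_le_sum fun i _ => ?_
        unfold mpay
        have := int_nonneg hx i v
        have : max (v i) 0 * x v i ≤ H * x v i :=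
          mul_le_mul_of_nonneg_right (max_le (hv i) hH.le) (hx.nonneg _ _)
        linarith
    _ = H * ∑ i, x v i := by rw [Finset.mul_sum]
    _ ≤ H * 1 := by gcongr; exact hx.sum_le v
    _ = H := mul_one H

lemma dsic_le {n : ℕ} {M : Mech n} (hM : DSIC M) (j : Fin n) (v : Fin n → ℝ) (a b : ℝ) :
    util M j a (update v j a) + (b - a) * M.alloc (update v j a) j ≤ util M j b (update v j b) := by
  have := hM j (update v j b) a
  simp only [update_self, update_idem, util] at this ⊢
  linarith

lemma alloc_isAlloc {n : ℕ} {M : Mech n} (hM : DSIC M) : IsAlloc M.alloc where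
  nonneg := M.alloc_nonneg
  sum_le := M.alloc_sum_le_one
  meas := M.meas_alloc
  mono j v := by
    intro a b hab
    rcases hab.eq_or_lt with rfl | hlt
    · exact le_rfl
    have h1 := dsic_le hM j v a b
    have h2 := dsic_le hM j v b a
    simp only
    by_contra hc
    push Not at hc
    nlinarith

lemma pay_le {n : ℕ} {M : Mech n} (hM : DSIC M) (hI : IR M) (v : Fin n → ℝ) (j : Fin n) :
    M.pay v j ≤ mpay M.alloc v j := by
  have h0 := hI j v
  unfold mpay
  rcases le_total (v j) 0 with h | h
  · rw [max_eq_right h]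
    simp only [util] at h0
    have := mul_nonpos_of_nonpos_of_nonneg h (M.alloc_nonneg v j)
    simp
    linarith
  · rw [max_eq_left h]
    have h1 := sub_int (u := fun a => util M j a (update v j a)) ((alloc_isAlloc hM).mono j v)
      (dsic_le hM j v) h
    have h2 := hI j (update v j 0)
    simp only [update_eq_self, update_self] at h1 h2
    rw [h1]
    simp only [util] at h2 ⊢
    linarith
end SingleItem
namespace SingleItem
open Function ProbabilityTheory

open Classical in
noncomputable def Qf (μ : Measure ℝ) (q : ℝ) : ℝ :=
  if q ∈ Ioo (0:ℝ) 1 then sInf {x | q ≤ cdf μ x} else 0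

lemma Qf_le_iff (μ : Measure ℝ) [IsProbabilityMeasure μ] {q : ℝ} (hq : q ∈ Ioo (0:ℝ) 1) (x : ℝ) :
    Qf μ q ≤ x ↔ q ≤ cdf μ x := by
  rw [Qf, if_pos hq]
  have hne : {x | q ≤ cdf μ x}.Nonempty := by
    have := (tendsto_cdf_atTop μ).eventually (lt_mem_nhds hq.2)
    obtain ⟨y, hy⟩ := this.exists
    exact ⟨y, hy.le⟩
  have hbd : BddBelow {x | q ≤ cdf μ x} := by
    have := (tendsto_cdf_atBot μ).eventually (gt_mem_nhds hq.1)
    obtain ⟨y, hy⟩ := this.exists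
    refine ⟨y, fun z hz => ?_⟩
    by_contra hc
    push Not at hc
    have := (monotone_cdf μ) hc.le
    have hz' : q ≤ cdf μ z := hz
    linarith
  constructor
  · intro h
    have hev : ∀ y > x, q ≤ cdf μ y := by
      intro y hy
      obtain ⟨z, hz, hzy⟩ := (csInf_lt_iff hbd hne).1 (lt_of_le_of_lt h hy)
      exact le_trans hz ((monotone_cdf μ) hzy.le)
    have hc : Filter.Tendsto (cdf μ) (nhdsWithin x (Ioi x)) (nhds (cdf μ x)) :=
      ((cdf μ).right_continuous x).mono_left (nhdsWithin_mono _ Ioi_subset_Ici_self)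
    exact ge_of_tendsto hc (by filter_upwards [self_mem_nhdsWithin] with y hy using hev y hy)
  · intro h
    exact csInf_le hbd h

lemma Qf_mono (μ : Measure ℝ) [IsProbabilityMeasure μ] : MonotoneOn (Qf μ) (Ioo 0 1) := by
  intro a ha b hb hab
  rw [Qf_le_iff μ ha]
  exact hab.trans ((Qf_le_iff μ hb _).1 le_rfl)

lemma Qf_meas (μ : Measure ℝ) [IsProbabilityMeasure μ] : Measurable (Qf μ) := by
  refine measurable_of_Iic fun x => ?_
  have : Qf μ ⁻¹' Iic x = (Ioo 0 1 ∩ Iic (cdf μ x)) ∪ ((Ioo 0 1)ᶜ ∩ {_q | (0:ℝ) ≤ x}) := by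
    ext q
    by_cases hq : q ∈ Ioo (0:ℝ) 1
    · simp only [mem_preimage, mem_Iic, mem_union, mem_inter_iff, mem_compl_iff, hq, Qf_le_iff μ hq]
      simp
    · simp only [mem_preimage, mem_Iic, mem_union, mem_inter_iff, mem_compl_iff, hq]
      simp [Qf, hq]
  rw [this]
  exact (measurableSet_Ioo.inter measurableSet_Iic).union
    (measurableSet_Ioo.compl.inter (MeasurableSet.const _))

lemma Qf_map (μ : Measure ℝ) [IsProbabilityMeasure μ] :
    Measure.map (Qf μ) (volume.restrict (Ioo (0:ℝ) 1)) = μ := by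
  have : IsFiniteMeasure (Measure.map (Qf μ) (volume.restrict (Ioo (0:ℝ) 1))) := by
    infer_instance
  refine Measure.ext_of_Iic _ _ fun x => ?_
  rw [Measure.map_apply (Qf_meas μ) measurableSet_Iic,
    Measure.restrict_apply (Qf_meas μ measurableSet_Iic)]
  have h1 : Qf μ ⁻¹' Iic x ∩ Ioo 0 1 = Ioo 0 1 ∩ Iic (cdf μ x) := by
    ext q
    simp only [mem_preimage, mem_Iic, mem_inter_iff]
    constructor
    · rintro ⟨a, b⟩; exact ⟨b, (Qf_le_iff μ b x).1 a⟩
    · rintro ⟨a, b⟩; exact ⟨(Qf_le_iff μ a x).2 b, a⟩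
  rw [h1]
  have h0 := cdf_nonneg μ x
  have h2 := cdf_le_one μ x
  have h3 : volume (Ioo 0 1 ∩ Iic (cdf μ x)) = volume (Ioc 0 (cdf μ x)) := by
    apply le_antisymm
    · exact measure_mono fun q hq => ⟨hq.1.1, hq.2⟩
    · rw [Real.volume_Ioc, ← Real.volume_Ioo]
      exact measure_mono fun q hq => ⟨⟨hq.1, lt_of_lt_of_le hq.2 h2⟩, hq.2.le⟩
  rw [h3, Real.volume_Ioc, sub_zero, cdf_eq_real, ofReal_measureReal]

lemma one_dim (μ ν : Measure ℝ) [IsProbabilityMeasure μ] [IsProbabilityMeasure ν]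
    {H ε δ : ℝ} (hH : 0 < H) (hε : 0 < ε) (hε1 : ε < 1) (hδ : 0 < δ)
    (hμ : μ (Iic H) = 1) (hK : KolmogorovLe μ ν ε)
    (f : ℝ → ℝ) (hf : Measurable f) (hf0 : ∀ t ≤ H, 0 ≤ f t) (hfH : ∀ t ≤ H, f t ≤ H) :
    ∃ (S : Set ℝ) (T : ℝ → ℝ), MeasurableSet S ∧ Measurable T ∧ IsUpperSet S ∧ MonotoneOn T S ∧
      (∀ s ∈ S, T s ≤ s) ∧ (∀ s ∈ S, T s ≤ H) ∧
      (∫ t, f t ∂μ) - H * ε - δ ≤ ∫ s, S.indicator (fun s => f (T s)) s ∂ν := by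
  classical
  set g : ℝ → ℝ := fun q => if ε < q then f (Qf μ (q - ε)) else 0 with hg
  have hQH : ∀ q ∈ Ioo (0:ℝ) 1, Qf μ q ≤ H := by
    intro q hq
    rw [Qf_le_iff μ hq, cdf_eq_real, Measure.real, hμ]
    simpa using hq.2.le
  have hgm : Measurable g := by
    refine Measurable.ite measurableSet_Ioi ?_ measurable_const
    exact hf.comp ((Qf_meas μ).comp (measurable_id.sub_const ε))
  have hgb : ∀ q, q ≤ 1 → 0 ≤ g q ∧ g q ≤ H := by
    intro q hq
    simp only [hg]
    split_ifs with h
    · have := hQH (q - ε) ⟨by linarith, by linarith⟩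
      exact ⟨hf0 _ this, hfH _ this⟩
    · exact ⟨le_rfl, hH.le⟩
  have hex : ∀ s, ∃ τ : ℝ, τ ≤ cdf ν s ∧ (∀ r < s, cdf ν r ≤ τ) ∧
      ∀ q ∈ Ioo (0:ℝ) 1, Qf ν q = s → g q - δ ≤ g τ := by
    intro s
    by_cases hA : ∃ q ∈ Ioo (0:ℝ) 1, Qf ν q = s
    · have hne : (g '' {q | q ∈ Ioo (0:ℝ) 1 ∧ Qf ν q = s}).Nonempty := by
        obtain ⟨q, hq, hqs⟩ := hA
        exact ⟨_, q, ⟨hq, hqs⟩, rfl⟩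
      have hbd : BddAbove (g '' {q | q ∈ Ioo (0:ℝ) 1 ∧ Qf ν q = s}) := by
        refine ⟨H, ?_⟩
        rintro _ ⟨q, hq, rfl⟩
        exact (hgb q hq.1.2.le).2
      obtain ⟨_, ⟨τ, ⟨hτ, hτs⟩, rfl⟩, hlt⟩ := exists_lt_of_lt_csSup hne
        (sub_lt_self _ hδ)
      refine ⟨τ, (Qf_le_iff ν hτ s).1 hτs.le, ?_, ?_⟩
      · intro r hr
        by_contra hc
        push Not at hc
        have := (Qf_le_iff ν hτ r).2 hc.le
        linarith
      · intro q hq hqs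
        have := le_csSup hbd ⟨q, ⟨hq, hqs⟩, rfl⟩
        linarith
    · refine ⟨cdf ν s, le_rfl, fun r hr => monotone_cdf ν hr.le, ?_⟩
      intro q hq hqs
      exact absurd ⟨q, hq, hqs⟩ hA
  choose τ hτ1 hτ2 hτ3 using hex
  have hτm : Monotone τ := by
    intro a b hab
    rcases hab.eq_or_lt with rfl | h
    · exact le_rfl
    · exact (hτ1 a).trans (hτ2 b a h)
  have hτ4 : ∀ s, τ s ≤ 1 := fun s => (hτ1 s).trans (cdf_le_one ν s)
  have hQint : ∀ s, ε < τ s → τ s - ε ∈ Ioo (0:ℝ) 1 := fun s hs =>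
    ⟨by linarith, by linarith [hτ4 s]⟩
  have hSm : MeasurableSet {s | ε < τ s} := measurableSet_lt measurable_const hτm.measurable
  have hTm : Measurable fun s => Qf μ (τ s - ε) := (Qf_meas μ).comp (hτm.measurable.sub_const ε)
  refine ⟨{s | ε < τ s}, fun s => Qf μ (τ s - ε), hSm, hTm,
    ?_, ?_, ?_, ?_, ?_⟩
  · intro a b hab ha
    exact lt_of_lt_of_le ha (hτm hab)
  · intro a ha b hb hab
    exact Qf_mono μ (hQint a ha) (hQint b hb) (by linarith [hτm hab])
  · intro s hs
    rw [Qf_le_iff μ (hQint s hs)]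
    have := hK s
    rw [abs_le] at this
    have h1 := hτ1 s
    rw [cdf_eq_real] at h1 ⊢
    simp only [Measure.real] at *
    linarith [this.1]
  · intro s hs
    exact hQH _ (hQint s hs)
  · have e1 : ∀ s, ({s | ε < τ s} : Set ℝ).indicator (fun s => f (Qf μ (τ s - ε))) s = g (τ s) := by
      intro s
      simp [hg, indicator_apply]
    simp_rw [e1]
    have hgτm : Measurable fun s => g (τ s) := hgm.comp hτm.measurable
    have e2 : ∫ s, g (τ s) ∂ν = ∫ q in Ioo (0:ℝ) 1, g (τ (Qf ν q)) := by
      conv_lhs => rw [← Qf_map ν]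
      rw [integral_map (Qf_meas ν).aemeasurable hgτm.aestronglyMeasurable]
    have e3 : ∫ t, f t ∂μ = ∫ q in Ioo (0:ℝ) 1, f (Qf μ q) := by
      conv_lhs => rw [← Qf_map μ]
      rw [integral_map (Qf_meas μ).aemeasurable hf.aestronglyMeasurable]
    have hbdint : ∀ {k : ℝ → ℝ}, Measurable k → (∀ q ∈ Ioo (0:ℝ) 1, 0 ≤ k q ∧ k q ≤ H) →
        IntegrableOn k (Ioo 0 1) := by
      intro k hk hb
      refine Measure.integrableOn_of_bounded (M := H) (by simp) hk.aestronglyMeasurable ?_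
      filter_upwards [ae_restrict_mem measurableSet_Ioo] with q hq
      rw [Real.norm_eq_abs, abs_of_nonneg (hb q hq).1]
      exact (hb q hq).2
    have i1 := hbdint hgm (fun q hq => hgb q hq.2.le)
    have i2 := hbdint (hgτm.comp (Qf_meas ν)) (fun q hq => hgb _ (hτ4 _))
    have i3 := hbdint (hf.comp (Qf_meas μ)) (fun q hq => ⟨hf0 _ (hQH q hq), hfH _ (hQH q hq)⟩)
    have e4 : (∫ q in Ioo (0:ℝ) 1, g q) - δ ≤ ∫ q in Ioo (0:ℝ) 1, g (τ (Qf ν q)) := by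
      have : ∫ q in Ioo (0:ℝ) 1, (g q - δ) ≤ ∫ q in Ioo (0:ℝ) 1, g (τ (Qf ν q)) := by
        refine setIntegral_mono_on (i1.sub (by simp)) i2 measurableSet_Ioo ?_
        intro q hq
        exact hτ3 _ q hq rfl
      rw [integral_sub i1 (by simp)] at this
      simpa using this
    have e5 : ∫ q in Ioo (0:ℝ) 1, g q = ∫ q in (0:ℝ)..(1 - ε), f (Qf μ q) := by
      have a1 : ∫ q in (0:ℝ)..(1 - ε), f (Qf μ q) = ∫ q in ε..1, f (Qf μ (q - ε)) := by
        rw [intervalIntegral.integral_comp_sub_right (fun q => f (Qf μ q))]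
        simp
      rw [a1, intervalIntegral.integral_of_le hε1.le, ← integral_Ioc_eq_integral_Ioo,
        ← integral_indicator measurableSet_Ioc, ← integral_indicator measurableSet_Ioc]
      congr 1
      ext q
      simp only [indicator_apply, hg, mem_Ioc]
      by_cases h1 : ε < q
      · simp [h1, hε.trans h1]
      · simp [h1]
    have e6 : ∫ q in Ioo (0:ℝ) 1, f (Qf μ q) = (∫ q in (0:ℝ)..(1 - ε), f (Qf μ q))
        + ∫ q in (1-ε)..1, f (Qf μ q) := by
      have i4 : IntervalIntegrable (fun q => f (Qf μ q)) volume 0 1 := by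
        rw [intervalIntegrable_iff_integrableOn_Ioo_of_le zero_le_one]; exact i3
      rw [intervalIntegral.integral_add_adjacent_intervals, intervalIntegral.integral_of_le
        zero_le_one, integral_Ioc_eq_integral_Ioo]
      · refine i4.mono_set ?_
        rw [uIcc_of_le (by linarith), uIcc_of_le zero_le_one]
        exact Icc_subset_Icc le_rfl (by linarith)
      · refine i4.mono_set ?_
        rw [uIcc_of_le (by linarith), uIcc_of_le zero_le_one]
        exact Icc_subset_Icc (by linarith) le_rfl
    have e7 : ∫ q in (1-ε)..1, f (Qf μ q) ≤ H * ε := by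
      rw [intervalIntegral.integral_of_le (by linarith), integral_Ioc_eq_integral_Ioo]
      have : ∫ q in Ioo (1-ε) 1, f (Qf μ q) ≤ ∫ q in Ioo (1-ε) 1, H := by
        refine setIntegral_mono_on (i3.mono_set (Ioo_subset_Ioo (by linarith) le_rfl)) (by simp)
          measurableSet_Ioo ?_
        intro q hq
        exact hfH _ (hQH q ⟨by linarith [hq.1], hq.2⟩)
      refine this.trans (le_of_eq ?_)
      simp [Measure.real, hε.le, mul_comm]
    linarith

lemma map_update {n : ℕ} (D : Fin n → Measure ℝ) [∀ j, IsProbabilityMeasure (D j)] (i : Fin n)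
    (ν : Measure ℝ) [IsProbabilityMeasure ν] (D' : Fin n → Measure ℝ)
    [∀ j, IsProbabilityMeasure (D' j)] (hi : D' i = ν) (hne : ∀ j, j ≠ i → D j = D' j) :
    Measurable (fun q : (Fin n → ℝ) × ℝ => update q.1 i q.2) ∧
    Measure.map (fun q : (Fin n → ℝ) × ℝ => update q.1 i q.2) ((Measure.pi D).prod ν)
      = Measure.pi D' := by
  have hm : Measurable (fun q : (Fin n → ℝ) × ℝ => update q.1 i q.2) := by
    rw [measurable_pi_iff]
    intro k
    by_cases hk : k = i
    · subst hk; simp only [update_self]; fun_prop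
    · simp only [update_of_ne hk]; fun_prop
  refine ⟨hm, ?_⟩
  symm
  refine Measure.pi_eq fun s hs => ?_
  rw [Measure.map_apply hm (MeasurableSet.univ_pi hs)]
  have : (fun q : (Fin n → ℝ) × ℝ => update q.1 i q.2) ⁻¹' univ.pi s
      = (univ.pi (update s i univ)) ×ˢ s i := by
    ext q
    simp only [mem_preimage, mem_univ_pi, mem_prod]
    constructor
    · intro h
      refine ⟨fun j => ?_, by simpa using h i⟩
      by_cases hj : j = i
      · subst hj; simp
      · simpa [hj] using h j
    · rintro ⟨h1, h2⟩ j
      by_cases hj : j = i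
      · subst hj; simpa using h2
      · simpa [hj] using h1 j
  rw [this, Measure.prod_prod, Measure.pi_pi, ← Finset.mul_prod_erase _ _ (Finset.mem_univ i),
    ← Finset.mul_prod_erase (a := i) Finset.univ (fun j => D' j (s j)) (Finset.mem_univ i), hi]
  simp only [update_self, measure_univ, one_mul]
  rw [mul_comm]
  congr 1
  refine Finset.prod_congr rfl fun j hj => ?_
  have hj := (Finset.mem_erase.1 hj).1
  rw [update_of_ne hj, hne j hj]
end SingleItem
namespace SingleItem
open Function ProbabilityTheory

open Classical in
noncomputable def xT {n : ℕ} (x : (Fin n → ℝ) → Fin n → ℝ) (i : Fin n) (S : Set ℝ) (T : ℝ → ℝ) :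
    (Fin n → ℝ) → Fin n → ℝ :=
  fun v j => if v i ∈ S then x (update v i (T (v i))) j else 0

lemma xT_upd {n : ℕ} (x : (Fin n → ℝ) → Fin n → ℝ) (i : Fin n) {S : Set ℝ} (T : ℝ → ℝ)
    (v : Fin n → ℝ) {s : ℝ} (j : Fin n) :
    (s ∈ S → xT x i S T (update v i s) j = x (update v i (T s)) j) ∧
    (s ∉ S → xT x i S T (update v i s) j = 0) := by
  constructor <;> intro hs <;> simp [xT, hs]

lemma xT_upd_ne {n : ℕ} (x : (Fin n → ℝ) → Fin n → ℝ) (i : Fin n) {S : Set ℝ} (T : ℝ → ℝ)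
    (v : Fin n → ℝ) (s : ℝ) {j : Fin n} (hj : j ≠ i) :
    (v i ∈ S → xT x i S T (update v j s) j = x (update (update v i (T (v i))) j s) j) ∧
    (v i ∉ S → xT x i S T (update v j s) j = 0) := by
  constructor <;> intro hs <;> simp [xT, hs, update_of_ne (Ne.symm hj), update_comm hj]

lemma meas_upd {n : ℕ} (i : Fin n) {T : ℝ → ℝ} (hT : Measurable T) :
    Measurable fun v : Fin n → ℝ => update v i (T (v i)) := by
  rw [measurable_pi_iff]
  intro k
  by_cases hk : k = i
  · subst hk; simp only [update_self]; fun_prop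
  · simp only [update_of_ne hk]; fun_prop

lemma xT_isAlloc {n : ℕ} {x : (Fin n → ℝ) → Fin n → ℝ} (hx : IsAlloc x) (i : Fin n) {S : Set ℝ}
    {T : ℝ → ℝ} (hS : MeasurableSet S) (hT : Measurable T) (hSu : IsUpperSet S)
    (hTm : MonotoneOn T S) : IsAlloc (xT x i S T) where
  nonneg b j := by unfold xT; split_ifs; exacts [hx.nonneg _ _, le_rfl]
  sum_le b := by
    unfold xT; split_ifs
    · exact hx.sum_le _
    · simp
  meas j := by
    unfold xT
    exact Measurable.ite (measurable_pi_apply i hS) ((hx.meas j).comp (meas_upd i hT))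
      measurable_const
  mono j v := by
    intro a b hab
    by_cases hj : j = i
    · subst hj
      simp only
      by_cases ha : a ∈ S
      · have hb := hSu hab ha
        rw [(xT_upd x j T v j).1 ha, (xT_upd x j T v j).1 hb]
        exact hx.mono j v (hTm ha hb hab)
      · rw [(xT_upd x j T v j).2 ha]
        unfold xT
        split_ifs
        exacts [hx.nonneg _ _, le_rfl]
    · simp only
      by_cases hs : v i ∈ S
      · rw [(xT_upd_ne x i T v a hj).1 hs, (xT_upd_ne x i T v b hj).1 hs]
        exact hx.mono j _ hab
      · rw [(xT_upd_ne x i T v a hj).2 hs, (xT_upd_ne x i T v b hj).2 hs]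

lemma xT_pay {n : ℕ} {x : (Fin n → ℝ) → Fin n → ℝ} (hx : IsAlloc x) (i : Fin n) {S : Set ℝ}
    {T : ℝ → ℝ} (hS : MeasurableSet S) (hT : Measurable T) (hSu : IsUpperSet S)
    (hTm : MonotoneOn T S) (hTle : ∀ s ∈ S, T s ≤ s) (v : Fin n → ℝ) (hv : v i ∈ S) (j : Fin n) :
    mpay x (update v i (T (v i))) j ≤ mpay (xT x i S T) v j := by
  have hx' := xT_isAlloc hx i hS hT hSu hTm
  by_cases hj : j = i
  · subst hj
    rcases le_total (T (v j)) 0 with h0 | h0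
    · refine le_trans (le_of_eq ?_) (mpay_nonneg hx' j v)
      simp [mpay, h0]
    · have hTv := hTle _ hv
      have hv0 : 0 ≤ v j := h0.trans hTv
      have hz := hx.mono j v
      have hz' := hx'.mono j v
      have hle : ∀ s, xT x j S T (update v j s) j ≤ x (update v j s) j := by
        intro s
        by_cases hs : s ∈ S
        · rw [(xT_upd x j T v j).1 hs]
          exact hz (hTle s hs)
        · rw [(xT_upd x j T v j).2 hs]
          exact hx.nonneg _ _
      have hxv : xT x j S T v j = x (update v j (T (v j))) j := by simp [xT, hv]
      simp only [mpay, update_self, update_idem, max_eq_left h0, max_eq_left hv0, hxv]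
      have h1 := mono_int hz' (T (v j)) (v j)
      simp only [update_eq_self, hxv] at h1
      have h2 := intervalIntegral.integral_add_adjacent_intervals (μ := volume)
        hz'.intervalIntegrable hz'.intervalIntegrable (a := 0) (b := T (v j)) (c := v j)
      have h3 : ∫ s in (0:ℝ)..T (v j), xT x j S T (update v j s) j
          ≤ ∫ s in (0:ℝ)..T (v j), x (update v j s) j :=
        intervalIntegral.integral_mono_on h0 hz'.intervalIntegrable hz.intervalIntegrable
          (fun s _ => hle s)
      linarith
  · refine le_of_eq ?_
    have h1 : xT x i S T v j = x (update v i (T (v i))) j := by simp [xT, hv]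
    have h2 : ∀ s, xT x i S T (update v j s) j = x (update (update v i (T (v i))) j s) j :=
      fun s => (xT_upd_ne x i T v s hj).1 hv
    simp only [mpay, update_of_ne hj, h1, h2]

lemma ae_le {n : ℕ} {H : ℝ} (D : Fin n → Measure ℝ) [∀ j, IsProbabilityMeasure (D j)]
    (hD : ∀ j, D j (Iic H) = 1) : ∀ᵐ v ∂(Measure.pi D), ∀ j, v j ≤ H := by
  rw [ae_all_iff]
  intro j
  have h1 : ∀ᵐ t ∂(D j), t ≤ H := by
    have := (prob_compl_eq_zero_iff (μ := D j) (measurableSet_Iic (a := H))).2 (hD j)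
    exact this
  exact (measurePreserving_eval D j).quasiMeasurePreserving.ae h1

lemma mpay_integrable {n : ℕ} {x : (Fin n → ℝ) → Fin n → ℝ} (hx : IsAlloc x) {H : ℝ} (hH : 0 < H)
    (D : Fin n → Measure ℝ) [∀ j, IsProbabilityMeasure (D j)] (hD : ∀ j, D j (Iic H) = 1) :
    Integrable (fun v => ∑ j, mpay x v j) (Measure.pi D) := by
  refine Integrable.of_bound (C := H)
    (Finset.measurable_sum _ fun j _ => meas_mpay hx j).aestronglyMeasurable ?_
  filter_upwards [ae_le D hD] with v hv
  rw [Real.norm_eq_abs, abs_of_nonneg (Finset.sum_nonneg fun j _ => mpay_nonneg hx j v)]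
  exact mpay_sum_le hx hH hv

lemma rev_le {n : ℕ} {M : Mech n} (hM : DSIC M) (hI : IR M) {H : ℝ} (hH : 0 < H)
    (D : Fin n → Measure ℝ) [∀ j, IsProbabilityMeasure (D j)] (hD : ∀ j, D j (Iic H) = 1) :
    Rev M (Measure.pi D) ≤ ∫ v, ∑ j, mpay M.alloc v j ∂(Measure.pi D) := by
  have hx := alloc_isAlloc hM
  unfold Rev
  by_cases hi : Integrable (fun b => ∑ i, M.pay b i) (Measure.pi D)
  · exact integral_mono hi (mpay_integrable hx hH D hD)
      fun v => Finset.sum_le_sum fun j _ => pay_le hM hI v j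
  · rw [integral_undef hi]
    exact integral_nonneg fun v => Finset.sum_nonneg fun j _ => mpay_nonneg hx j v

lemma mpay_int_le {n : ℕ} {x : (Fin n → ℝ) → Fin n → ℝ} (hx : IsAlloc x) {H : ℝ} (hH : 0 < H)
    (D : Fin n → Measure ℝ) [∀ j, IsProbabilityMeasure (D j)] (hD : ∀ j, D j (Iic H) = 1) :
    ∫ v, ∑ j, mpay x v j ∂(Measure.pi D) ≤ H := by
  calc _ ≤ ∫ v, H ∂(Measure.pi D) := by
        refine integral_mono_ae (mpay_integrable hx hH D hD) (integrable_const _) ?_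
        filter_upwards [ae_le D hD] with v hv using mpay_sum_le hx hH hv
    _ = H := by simp

lemma le_OPT {n : ℕ} {M : Mech n} (hM : DSIC M) (hI : IR M) {H : ℝ} (hH : 0 < H)
    (D : Fin n → Measure ℝ) [∀ j, IsProbabilityMeasure (D j)] (hD : ∀ j, D j (Iic H) = 1) :
    Rev M (Measure.pi D) ≤ OPT (Measure.pi D) := by
  refine le_csSup ⟨H, ?_⟩ ⟨M, hM, hI, rfl⟩
  rintro _ ⟨M, hM, hI, rfl⟩
  exact (rev_le hM hI hH D hD).trans (mpay_int_le (alloc_isAlloc hM) hH D hD)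

lemma zero_isAlloc {n : ℕ} : IsAlloc (fun (_ : Fin n → ℝ) (_ : Fin n) => (0:ℝ)) where
  nonneg _ _ := le_rfl
  sum_le _ := by simp
  meas _ := measurable_const
  mono _ _ := monotone_const

lemma main_step {n : ℕ} {H ε : ℝ} (hH : 0 < H) (hε : 0 < ε) (hε1 : ε < 1)
    (D D' : Fin n → Measure ℝ) (i : Fin n)
    [∀ j, IsProbabilityMeasure (D j)] [∀ j, IsProbabilityMeasure (D' j)]
    (hDsupp : ∀ j, D j (Iic H) = 1) (hD'supp : ∀ j, D' j (Iic H) = 1)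
    (heq : ∀ j, j ≠ i → D j = D' j) (hK : KolmogorovLe (D i) (D' i) ε)
    {x : (Fin n → ℝ) → Fin n → ℝ} (hx : IsAlloc x) :
    ∃ M : Mech n, DSIC M ∧ IR M ∧
      (∫ v, ∑ j, mpay x v j ∂(Measure.pi D)) - H * ε - H * ε ≤ Rev M (Measure.pi D') := by
  classical
  set P : (Fin n → ℝ) → ℝ := fun v => ∑ j, mpay x v j with hP
  have hPm : Measurable P := Finset.measurable_sum _ fun j _ => meas_mpay hx j
  have hP0 : ∀ v, 0 ≤ P v := fun v => Finset.sum_nonneg fun j _ => mpay_nonneg hx j v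
  obtain ⟨hum, hu1⟩ := map_update D i (D i) D rfl (fun _ _ => rfl)
  obtain ⟨-, hu2⟩ := map_update D i (D' i) D' rfl heq
  set f : ℝ → ℝ := fun t => ∫ v, P (update v i t) ∂(Measure.pi D) with hf
  have hPum : Measurable fun q : (Fin n → ℝ) × ℝ => P (update q.1 i q.2) := hPm.comp hum
  have hfm : Measurable f := hPum.stronglyMeasurable.integral_prod_left'.measurable
  have hf0 : ∀ t, 0 ≤ f t := fun t => integral_nonneg fun v => hP0 _
  have hPb : ∀ t ≤ H, ∀ᵐ v ∂(Measure.pi D), P (update v i t) ≤ H := by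
    intro t ht
    filter_upwards [ae_le D hDsupp] with v hv
    refine mpay_sum_le hx hH fun j => ?_
    by_cases hj : j = i
    · subst hj; simpa using ht
    · simpa [hj] using hv j
  have hfH : ∀ t ≤ H, f t ≤ H := by
    intro t ht
    calc f t ≤ ∫ v, H ∂(Measure.pi D) :=
          integral_mono_of_nonneg (ae_of_all _ fun v => hP0 _) (integrable_const _) (hPb t ht)
      _ = H := by simp
  obtain ⟨S, T, hS, hT, hSu, hTm, hTle, hTH, hmain⟩ := one_dim (D i) (D' i) hH hε hε1
    (mul_pos hH hε) (hDsupp i) hK f hfm (fun t _ => hf0 t) hfH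
  have hx' := xT_isAlloc hx i hS hT hSu hTm
  refine ⟨mye _ hx', mye_DSIC hx', mye_IR hx', ?_⟩
  have e1 : ∫ v, P v ∂(Measure.pi D) = ∫ t, f t ∂(D i) := by
    have hi : Integrable P (Measure.pi D) := mpay_integrable hx hH D hDsupp
    conv_lhs => rw [← hu1]
    rw [integral_map hum.aemeasurable hPm.aestronglyMeasurable, integral_prod_symm]
    rw [← hu1] at hi
    exact hi.comp_measurable hum
  set G : (Fin n → ℝ) → ℝ := fun v => S.indicator (fun s => P (update v i (T s))) (v i) with hG
  have hG' : G = ((fun v : Fin n → ℝ => v i) ⁻¹' S).indicator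
      (fun v => P (update v i (T (v i)))) := by
    ext v; simp [hG, indicator_apply]
  have hGm : Measurable G := by
    rw [hG']
    exact (hPm.comp (meas_upd i hT)).indicator (measurable_pi_apply i hS)
  have hG0 : ∀ v, 0 ≤ G v := fun v => indicator_nonneg (fun s _ => hP0 _) _
  have hGle : ∀ v, G v ≤ ∑ j, mpay (xT x i S T) v j := by
    intro v
    by_cases hv : v i ∈ S
    · simp only [hG, indicator_of_mem hv, hP]
      exact Finset.sum_le_sum fun j _ => xT_pay hx i hS hT hSu hTm hTle v hv j
    · simp only [hG, indicator_of_notMem hv]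
      exact Finset.sum_nonneg fun j _ => mpay_nonneg hx' j v
  have hi' := mpay_integrable hx' hH D' hD'supp
  have hGi : Integrable G (Measure.pi D') := by
    refine hi'.mono' hGm.aestronglyMeasurable (ae_of_all _ fun v => ?_)
    rw [Real.norm_eq_abs, abs_of_nonneg (hG0 v)]
    exact hGle v
  have e2 : ∫ v, G v ∂(Measure.pi D') = ∫ s, S.indicator (fun s => f (T s)) s ∂(D' i) := by
    conv_lhs => rw [← hu2]
    rw [integral_map hum.aemeasurable hGm.aestronglyMeasurable, integral_prod_symm]
    · congr 1
      ext s
      simp only [hG, update_self, update_idem]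
      by_cases hs : s ∈ S
      · simp [hs, hf]
      · simp [hs]
    · rw [← hu2] at hGi
      exact hGi.comp_measurable hum
  have e3 : ∫ v, G v ∂(Measure.pi D') ≤ Rev (mye _ hx') (Measure.pi D') :=
    integral_mono hGi hi' hGle
  linarith
end SingleItem

open SingleItem

/-- single-coordinate Kolmogorov-robustness, single item: if the product
distributions `D` and `D'` on `(-∞,H]^n` differ only in coordinate `i`, where their factors
are within Kolmogorov distance `ε`, then `OPT(D') ≥ OPT(D) − 3H·ε`. -/
theorem stmt2 (n : ℕ) (H ε : ℝ) (hH : 0 < H) (hε : 0 < ε)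
    (D D' : Fin n → Measure ℝ) (i : Fin n)
    (hDprob : ∀ j, IsProbabilityMeasure (D j))
    (hD'prob : ∀ j, IsProbabilityMeasure (D' j))
    (hDsupp : ∀ j, D j (Iic H) = 1)
    (hD'supp : ∀ j, D' j (Iic H) = 1)
    (heq : ∀ j, j ≠ i → D j = D' j)
    (hK : KolmogorovLe (D i) (D' i) ε) :
    OPT (Measure.pi D) - 3 * H * ε ≤ OPT (Measure.pi D') := by
  have hHε := mul_pos hH hε
  rw [sub_le_iff_le_add]
  refine csSup_le ⟨_, mye _ zero_isAlloc, mye_DSIC _, mye_IR _, rfl⟩ ?_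
  rintro _ ⟨M, hM, hI, rfl⟩
  have h1 := rev_le hM hI hH D hDsupp
  have hx := alloc_isAlloc hM
  rcases lt_or_ge ε 1 with hε1 | hε1
  · obtain ⟨M', hM', hI', h2⟩ := main_step hH hε hε1 D D' i hDsupp hD'supp heq hK hx
    have h3 := le_OPT hM' hI' hH D' hD'supp
    linarith
  · have h2 := mpay_int_le hx hH D hDsupp
    have h3 := le_OPT (mye_DSIC zero_isAlloc) (mye_IR zero_isAlloc) hH D' hD'supp
    have h4 : 0 ≤ Rev (mye _ zero_isAlloc) (Measure.pi D') :=
      integral_nonneg fun v => Finset.sum_nonneg fun j _ => mpay_nonneg zero_isAlloc j v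
    nlinarith
end

section
/- There exist absolute constants C₁, C₂ such that the following holds. Let D = ×_{i=1}^n D_i be a product distribution with each D_i supported on [0,H]^m, and let M be a BIC (with respect to D) and IR mechanism. Then there is a (randomized) mechanism M̂, constructed from M and D alone, such that for every product distribution D̂ = ×_{i=1}^n D̂_i supported on ([0,H]^m)^n with Prokhorov distance ‖D_i − D̂_i‖_P ≤ ε for all i: (1) M̂ is κ-BIC with respect to D̂ and IR, where κ = C₁·(nmLHε + mL√(nHε)); and (2) Rev_T(M̂, D̂) ≥ Rev(M, D) − C₂·n·κ. -/
open MeasureTheory Set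

namespace MultiItem

/-- Feasible deterministic allocations of `m` items to `n` bidders: each item goes to at
most one bidder. -/
def Alloc (n m : ℕ) : Type :=
  {x : Fin n → Fin m → Bool // ∀ j : Fin m, (Finset.univ.filter fun i => x i j = true).card ≤ 1}

instance (n m : ℕ) : Fintype (Alloc n m) := by
  unfold Alloc; infer_instance

instance (n m : ℕ) : DecidableEq (Alloc n m) := by
  unfold Alloc; infer_instance

/-- The empty allocation: nobody gets anything. -/
def emptyAlloc (n m : ℕ) : Alloc n m :=
  ⟨fun _ _ => false, by intro j; simp⟩

/-- Measurable-space structure on `Option α`: a set is measurable iff its preimage under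
`some` is measurable. -/
instance {α : Type*} [m₀ : MeasurableSpace α] : MeasurableSpace (Option α) :=
  MeasurableSpace.map some m₀

/-- A (randomized) multi-item mechanism, represented by the distribution over allocations
and the expected payments induced on each bid profile; the bid `none` is the
non-participation symbol `⊥`, which results in the empty allocation and zero payments. -/
structure Mechanism (n m : ℕ) where
  allocProb : (Fin n → Option (Fin m → ℝ)) → Alloc n m → ℝ
  pay : (Fin n → Option (Fin m → ℝ)) → Fin n → ℝ
  allocProb_nonneg : ∀ b x, 0 ≤ allocProb b x
  allocProb_sum_one : ∀ b, ∑ x : Alloc n m, allocProb b x = 1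
  optOut : ∀ b, (∃ i, b i = none) →
    (allocProb b = fun x => if x = emptyAlloc n m then 1 else 0) ∧ pay b = fun _ => 0
  meas_allocProb : ∀ x, Measurable fun b => allocProb b x
  meas_pay : ∀ i, Measurable fun b => pay b i

variable {n m : ℕ}

/-- Expected utility of bidder `i` with type `t` under bid profile `b`, for the valuation
profile `v`. -/
def util (v : Fin n → (Fin m → ℝ) → Alloc n m → ℝ) (M : Mechanism n m)
    (i : Fin n) (t : Fin m → ℝ) (b : Fin n → Option (Fin m → ℝ)) : ℝ :=
  (∑ x : Alloc n m, M.allocProb b x * v i t x) - M.pay b i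

/-- (Ex-post) individual rationality on type profiles from `[0,H]^m`. -/
def IsIR (H : ℝ) (v : Fin n → (Fin m → ℝ) → Alloc n m → ℝ) (M : Mechanism n m) : Prop :=
  ∀ t : Fin n → Fin m → ℝ, (∀ i j, t i j ∈ Icc (0:ℝ) H) →
    ∀ i, 0 ≤ util v M i (t i) fun j => some (t j)

/-- Interim expected utility of bidder `i` with type `t` bidding `bid`, when all other
bidders bid their true types drawn from `D`. -/
noncomputable def interim (v : Fin n → (Fin m → ℝ) → Alloc n m → ℝ) (M : Mechanism n m)
    (D : Fin n → Measure (Fin m → ℝ)) (i : Fin n) (t : Fin m → ℝ)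
    (bid : Option (Fin m → ℝ)) : ℝ :=
  ∫ b, util v M i t (fun j => if j = i then bid else some (b j)) ∂(Measure.pi D)

/-- The (topological) support of a measure. -/
def msupport {α : Type*} [TopologicalSpace α] [MeasurableSpace α] (μ : Measure α) : Set α :=
  {x | ∀ U : Set α, IsOpen U → x ∈ U → 0 < μ U}

/-- `η`-Bayesian incentive compatibility w.r.t. the product of the `D i` (misreports range
over types in `[0,H]^m` and the non-participation bid `⊥`). -/
def IsBIC (η H : ℝ) (v : Fin n → (Fin m → ℝ) → Alloc n m → ℝ)
    (M : Mechanism n m) (D : Fin n → Measure (Fin m → ℝ)) : Prop :=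
  ∀ i : Fin n, ∀ t ∈ msupport (D i), ∀ bid : Option (Fin m → ℝ),
    (∀ s ∈ bid, ∀ j, s j ∈ Icc (0:ℝ) H) →
    interim v M D i t bid ≤ interim v M D i t (some t) + η

/-- Expected revenue under truthful bidding from `D`. -/
noncomputable def RevT (M : Mechanism n m) (D : Fin n → Measure (Fin m → ℝ)) : ℝ :=
  ∫ b, (∑ i, M.pay (fun j => some (b j)) i) ∂(Measure.pi D)

/-- Optimal revenue over `η`-BIC and IR mechanisms. -/
noncomputable def OPT (η H : ℝ) (v : Fin n → (Fin m → ℝ) → Alloc n m → ℝ)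
    (D : Fin n → Measure (Fin m → ℝ)) : ℝ :=
  sSup {r | ∃ M : Mechanism n m, IsIR H v M ∧ IsBIC η H v M D ∧ r = RevT M D}

/-- The distribution is supported on the box `[0,H]^m`. -/
def suppBox (H : ℝ) (μ : Measure (Fin m → ℝ)) : Prop :=
  μ {t | ∀ j, t j ∈ Icc (0:ℝ) H} = 1

/-- The total variation distance between `P` and `Q` is at most `ε`. -/
def TVLe {α : Type*} [MeasurableSpace α] (P Q : Measure α) (ε : ℝ) : Prop :=
  ∀ A : Set α, MeasurableSet A → |(P A).toReal - (Q A).toReal| ≤ ε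

/-- The total variation distance between two measures. -/
noncomputable def tvDist {α : Type*} [MeasurableSpace α] (P Q : Measure α) : ℝ :=
  sSup {r | ∃ A : Set α, MeasurableSet A ∧ r = |(P A).toReal - (Q A).toReal|}

/-- The Prokhorov distance (w.r.t. the `ℓ1` metric) between `P` and `Q` is at most `ε`. -/
def ProkhorovLe {k : ℕ} (P Q : Measure (Fin k → ℝ)) (ε : ℝ) : Prop :=
  ∀ ε' : ℝ, ε < ε' → ∀ A : Set (Fin k → ℝ), MeasurableSet A →
    P A ≤ Q {x | ∃ y ∈ A, (∑ j, |x j - y j|) < ε'} + ENNReal.ofReal ε' ∧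
    Q A ≤ P {x | ∃ y ∈ A, (∑ j, |x j - y j|) < ε'} + ENNReal.ofReal ε'

/-- Round `x ≥ 0` down to the grid `{0} ∪ {ℓ + i·δ : i ∈ ℤ≥0}`. -/
noncomputable def roundPt (ℓ δ x : ℝ) : ℝ :=
  if x < ℓ then 0 else ℓ + ⌊(x - ℓ) / δ⌋ * δ

/-- The pushforward `⌊F⌋_{ℓ,δ}` of a distribution under coordinatewise rounding. -/
noncomputable def roundMeasure {k : ℕ} (ℓ : Fin k → ℝ) (δ : ℝ)
    (F : Measure (Fin k → ℝ)) : Measure (Fin k → ℝ) :=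
  F.map fun x j => roundPt (ℓ j) δ (x j)

end MultiItem

open MultiItem


/-- clamp to `[0,1]`. -/
noncomputable def cl01 (y : ℝ) : ℝ := max 0 (min 1 y)

theorem cl01_mono {x y : ℝ} (h : x ≤ y) : cl01 x ≤ cl01 y := by
  unfold cl01; exact max_le_max le_rfl (min_le_min le_rfl h)

theorem cl01_sum (N : ℕ) (y : ℝ) : ∑ k ∈ Finset.range N, cl01 (y - k) = max 0 (min (N:ℝ) y) := by
  induction N with
  | zero => simp
  | succ N ih =>
    rw [Finset.sum_range_succ, ih]
    have hN : (0:ℝ) ≤ N := Nat.cast_nonneg N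
    unfold cl01
    push_cast
    simp only [max_def, min_def]
    split_ifs <;> linarith

theorem cl01_continuous : Continuous cl01 := by unfold cl01; fun_prop

/-- clamp of `x / δ` to `[0,N]`. -/
noncomputable def clN (N : ℕ) (δ x : ℝ) : ℝ := max 0 (min N (x / δ))

/-- one-dimensional hat functions. -/
noncomputable def hat (N : ℕ) (δ : ℝ) (k : ℕ) (x : ℝ) : ℝ :=
  cl01 (clN N δ x - k + 1) - cl01 (clN N δ x - k)

theorem hat_continuous (N : ℕ) (δ : ℝ) (k : ℕ) : Continuous (hat N δ k) := by
  unfold hat clN cl01; fun_prop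

theorem hat_nonneg (N : ℕ) (δ : ℝ) (k : ℕ) (x : ℝ) : 0 ≤ hat N δ k x := by
  unfold hat
  have := cl01_mono (show clN N δ x - k ≤ clN N δ x - k + 1 by linarith)
  linarith

theorem clN_mem (N : ℕ) (δ x : ℝ) : 0 ≤ clN N δ x ∧ clN N δ x ≤ N := by
  unfold clN
  exact ⟨le_max_left _ _, max_le (Nat.cast_nonneg N) (min_le_left _ _)⟩

theorem hat_sum (N : ℕ) (δ x : ℝ) : ∑ k : Fin (N+1), hat N δ k x = 1 := by
  rw [Fin.sum_univ_eq_sum_range (fun k => hat N δ k x)]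
  have h := Finset.sum_range_sub' (fun k : ℕ => cl01 (clN N δ x - k + 1)) (N+1)
  have h2 : ∀ k : ℕ, hat N δ k x = cl01 (clN N δ x - (k:ℕ) + 1) - cl01 (clN N δ x - ((k+1:ℕ):ℝ) + 1) := by
    intro k; unfold hat; push_cast; congr 2; ring
  simp_rw [h2]
  rw [h]
  obtain ⟨h0, h1⟩ := clN_mem N δ x
  have e1 : cl01 (clN N δ x - ((0:ℕ):ℝ) + 1) = 1 := by
    unfold cl01; rw [min_eq_left (by push_cast; linarith)]; simp
  have e2 : cl01 (clN N δ x - ((N+1:ℕ):ℝ) + 1) = 0 := by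
    unfold cl01; apply max_eq_left; apply min_le_of_right_le; push_cast; linarith
  rw [e1, e2]; simp

theorem clN_lip (N : ℕ) (δ : ℝ) (hδ : 0 < δ) {x y : ℝ} (h : x ≤ y) :
    0 ≤ clN N δ y - clN N δ x ∧ clN N δ y - clN N δ x ≤ (y - x) / δ := by
  have h1 : x / δ ≤ y / δ := by gcongr
  have h2 : (y - x) / δ = y / δ - x / δ := by ring
  rw [h2]
  have hN : (0:ℝ) ≤ N := Nat.cast_nonneg N
  unfold clN
  simp only [max_def, min_def]
  split_ifs <;> constructor <;> linarith

theorem hat_lip_aux (N : ℕ) (δ : ℝ) (hδ : 0 < δ) {x y : ℝ} (h : x ≤ y) :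
    ∑ k : Fin (N+1), |hat N δ k x - hat N δ k y| ≤ 2 / δ * |x - y| := by
  rw [Fin.sum_univ_eq_sum_range (fun k => |hat N δ k x - hat N δ k y|)]
  obtain ⟨g0, g1⟩ := clN_lip N δ hδ h
  obtain ⟨hx0, hx1⟩ := clN_mem N δ x
  obtain ⟨hy0, hy1⟩ := clN_mem N δ y
  set a := clN N δ x
  set b := clN N δ y
  have hk : ∀ k ∈ Finset.range (N+1), |hat N δ k x - hat N δ k y| ≤
      (cl01 ((b + 1) - k) - cl01 ((a + 1) - k)) + (cl01 (b - k) - cl01 (a - k)) := by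
    intro k _
    have e1 := cl01_mono (show (a + 1) - (k:ℝ) ≤ (b + 1) - k by linarith)
    have e2 := cl01_mono (show a - (k:ℝ) ≤ b - k by linarith)
    unfold hat
    rw [show clN N δ x - (k:ℝ) + 1 = a + 1 - k by ring, show clN N δ y - (k:ℝ) + 1 = b + 1 - k by ring]
    rw [abs_le]; constructor <;> linarith
  refine (Finset.sum_le_sum hk).trans ?_
  rw [Finset.sum_add_distrib, Finset.sum_sub_distrib, Finset.sum_sub_distrib]
  simp only [cl01_sum]
  have hc : ∀ z : ℝ, 0 ≤ z → z ≤ N + 1 → max 0 (min ((N+1:ℕ):ℝ) z) = z := by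
    intro z h0 h1
    push_cast
    rw [min_eq_right h1, max_eq_right h0]
  rw [hc _ (by linarith) (by linarith), hc _ (by linarith) (by linarith), hc _ (by linarith) (by linarith),
    hc _ (by linarith) (by linarith), abs_sub_comm, abs_of_nonneg (by linarith)]
  have : 2 / δ * (y - x) = 2 * ((y - x) / δ) := by ring
  linarith

theorem hat_lip (N : ℕ) (δ : ℝ) (hδ : 0 < δ) (x y : ℝ) :
    ∑ k : Fin (N+1), |hat N δ k x - hat N δ k y| ≤ 2 / δ * |x - y| := by
  rcases le_total x y with h | h
  · exact hat_lip_aux N δ hδ h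
  · have := hat_lip_aux N δ hδ h
    simpa [abs_sub_comm] using this

theorem hat_local (N : ℕ) (δ H : ℝ) (hδ : 0 < δ) (hN : H ≤ N * δ) (k : ℕ) {x : ℝ}
    (hx : x ∈ Icc 0 H) (h : hat N δ k x ≠ 0) : |x - k * δ| ≤ δ := by
  have hy : clN N δ x = x / δ := by
    unfold clN
    rw [min_eq_right, max_eq_right]
    · exact div_nonneg hx.1 hδ.le
    · rw [div_le_iff₀ hδ]; exact hx.2.trans hN
  have hxe : x = (x / δ) * δ := by field_simp
  set y := x / δ
  unfold hat at h
  rw [hy] at h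
  have : |y - k| ≤ 1 := by
    by_contra hc
    apply h
    rw [not_le, lt_abs] at hc
    unfold cl01
    rcases hc with hc | hc
    · rw [min_eq_left (by linarith), min_eq_left (by linarith)]; simp
    · rw [max_eq_left (min_le_of_right_le (by linarith)), max_eq_left (min_le_of_right_le (by linarith))]; simp
  rw [hxe, ← sub_mul, abs_mul, abs_of_pos hδ]
  nlinarith

/-- products of probability vectors: `ℓ1` distance is subadditive. -/
theorem prod_tv {ι κ : Type*} [Fintype ι] [DecidableEq ι] [Fintype κ] (p q : ι → κ → ℝ)
    (hp : ∀ i k, 0 ≤ p i k) (hq : ∀ i k, 0 ≤ q i k)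
    (hp1 : ∀ i, ∑ k, p i k = 1) (hq1 : ∀ i, ∑ k, q i k = 1) :
    ∑ k : ι → κ, |∏ i, p i (k i) - ∏ i, q i (k i)| ≤ ∑ i, ∑ k, |p i k - q i k| := by
  classical
  let h : Finset ι → ι → κ → ℝ := fun S i => if i ∈ S then p i else q i
  have key : ∀ S : Finset ι,
      ∑ k : ι → κ, |∏ i, h S i (k i) - ∏ i, q i (k i)| ≤ ∑ i ∈ S, ∑ k, |p i k - q i k| := by
    intro S
    induction S using Finset.induction_on with
    | empty => simp [h]
    | insert a S ha ih =>
      rw [Finset.sum_insert ha]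
      have tri : ∀ k : ι → κ, |∏ i, h (insert a S) i (k i) - ∏ i, q i (k i)| ≤
          |∏ i, h (insert a S) i (k i) - ∏ i, h S i (k i)| + |∏ i, h S i (k i) - ∏ i, q i (k i)| :=
        fun k => abs_sub_le _ _ _
      refine (Finset.sum_le_sum fun k _ => tri k).trans ?_
      rw [Finset.sum_add_distrib]
      refine add_le_add ?_ ih
      -- one coordinate
      let g : ι → κ → ℝ := fun i k => if i = a then |p a k - q a k| else h S i k
      have e : ∀ k : ι → κ, |∏ i, h (insert a S) i (k i) - ∏ i, h S i (k i)| = ∏ i, g i (k i) := by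
        intro k
        rw [← Finset.mul_prod_erase _ _ (Finset.mem_univ a),
          ← Finset.mul_prod_erase _ (fun i => h S i (k i)) (Finset.mem_univ a),
          ← Finset.mul_prod_erase _ (fun i => g i (k i)) (Finset.mem_univ a)]
        have e1 : ∏ i ∈ Finset.univ.erase a, h (insert a S) i (k i) =
            ∏ i ∈ Finset.univ.erase a, h S i (k i) := by
          apply Finset.prod_congr rfl
          intro i hi
          have : i ≠ a := Finset.ne_of_mem_erase hi
          simp [h, this]
        have e2 : ∏ i ∈ Finset.univ.erase a, g i (k i) =
            ∏ i ∈ Finset.univ.erase a, h S i (k i) := by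
          apply Finset.prod_congr rfl
          intro i hi
          have : i ≠ a := Finset.ne_of_mem_erase hi
          simp [g, this]
        rw [e1, e2, ← sub_mul, abs_mul, abs_of_nonneg (a := ∏ i ∈ Finset.univ.erase a, h S i (k i))]
        · simp [g, h, ha]
        · apply Finset.prod_nonneg
          intro i _
          simp only [h]; split_ifs
          · exact hp _ _
          · exact hq _ _
      simp_rw [e]
      rw [← Fintype.prod_sum (fun i k => g i k)]
      rw [← Finset.mul_prod_erase _ _ (Finset.mem_univ a)]
      have : ∏ i ∈ Finset.univ.erase a, ∑ k, g i k = 1 := by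
        apply Finset.prod_eq_one
        intro i hi
        have : i ≠ a := Finset.ne_of_mem_erase hi
        simp only [g, this, if_false, h]
        split_ifs
        · exact hp1 _
        · exact hq1 _
      rw [this]
      simp [g]
  simpa [h] using key Finset.univ

theorem pou (m : ℕ) (H δ : ℝ) (hH : 0 < H) (hδ : 0 < δ) :
    ∃ (K : Type) (_ : Fintype K) (φ : K → (Fin m → ℝ) → ℝ) (c : K → Fin m → ℝ),
      (∀ κ, Continuous (φ κ)) ∧ (∀ κ t, 0 ≤ φ κ t) ∧ (∀ t, ∑ κ, φ κ t = 1) ∧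
      (∀ κ j, c κ j ∈ Icc (0:ℝ) H) ∧
      (∀ κ s t, (∀ j, s j ∈ Icc (0:ℝ) H) → (∀ j, t j ∈ Icc (0:ℝ) H) → φ κ s ≠ 0 → φ κ t ≠ 0 →
        ∑ j, |s j - t j| ≤ 2 * m * δ) ∧
      (∀ κ t, (∀ j, t j ∈ Icc (0:ℝ) H) → φ κ t ≠ 0 → ∑ j, |t j - c κ j| ≤ 2 * m * δ) ∧
      (∀ s t, ∑ κ, |φ κ s - φ κ t| ≤ 2 / δ * ∑ j, |s j - t j|) := by
  classical
  obtain ⟨N, hN⟩ := exists_nat_ge (H / δ)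
  rw [div_le_iff₀ hδ] at hN
  let φ : (Fin m → Fin (N+1)) → (Fin m → ℝ) → ℝ := fun κ t => ∏ j, hat N δ (κ j) (t j)
  have hloc : ∀ κ s t, (∀ j, s j ∈ Icc (0:ℝ) H) → (∀ j, t j ∈ Icc (0:ℝ) H) → φ κ s ≠ 0 → φ κ t ≠ 0 →
        ∑ j, |s j - t j| ≤ 2 * m * δ := by
    intro κ s t hs ht h1 h2
    have : ∀ j ∈ Finset.univ, |s j - t j| ≤ 2 * δ := by
      intro j _
      have a1 := hat_local N δ H hδ hN (κ j) (hs j) (Finset.prod_ne_zero_iff.1 h1 j (Finset.mem_univ j))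
      have a2 := hat_local N δ H hδ hN (κ j) (ht j) (Finset.prod_ne_zero_iff.1 h2 j (Finset.mem_univ j))
      have := abs_sub_le (s j) ((κ j : ℕ) * δ) (t j)
      rw [abs_sub_comm ((κ j : ℕ) * δ : ℝ) (t j)] at this
      linarith
    refine (Finset.sum_le_sum this).trans ?_
    simp; linarith
  let P : (Fin m → Fin (N+1)) → (Fin m → ℝ) → Prop := fun κ t => (∀ j, t j ∈ Icc (0:ℝ) H) ∧ φ κ t ≠ 0
  refine ⟨Fin m → Fin (N+1), inferInstance, φ,
    fun κ => if h : ∃ t, P κ t then h.choose else 0, ?_, ?_, ?_, ?_, hloc, ?_, ?_⟩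
  · intro κ
    exact continuous_finsetProd _ fun j _ => (hat_continuous N δ (κ j)).comp (continuous_apply j)
  · intro κ t; exact Finset.prod_nonneg fun j _ => hat_nonneg _ _ _ _
  · intro t
    simp only [φ]
    rw [← Fintype.prod_sum (fun (j : Fin m) (k : Fin (N+1)) => hat N δ k (t j))]
    simp [hat_sum]
  · intro κ j
    by_cases h : ∃ t, P κ t
    · simp only [h, dif_pos]; exact h.choose_spec.1 j
    · simp only [h, dif_neg, not_false_eq_true]; simp [hH.le]
  · intro κ t ht hne
    have h : ∃ t, P κ t := ⟨t, ht, hne⟩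
    simp only [h, dif_pos]
    exact hloc κ t _ ht h.choose_spec.1 hne h.choose_spec.2
  · intro s t
    refine (prod_tv (fun j (k : Fin (N+1)) => hat N δ k (s j)) (fun j k => hat N δ k (t j))
      (fun _ _ => hat_nonneg _ _ _ _) (fun _ _ => hat_nonneg _ _ _ _)
      (fun _ => hat_sum _ _ _) (fun _ => hat_sum _ _ _)).trans ?_
    rw [Finset.mul_sum]
    exact Finset.sum_le_sum fun j _ => hat_lip N δ hδ _ _



theorem nhd_lintegral {k : ℕ} (P Q : Measure (Fin k → ℝ)) [IsProbabilityMeasure P] [IsProbabilityMeasure Q]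
    (g : (Fin k → ℝ) → ℝ) (hg : Continuous g) (B Λ e : ℝ) (hΛ : 0 ≤ Λ) (he : 0 < e)
    (h0 : ∀ t, 0 ≤ g t) (hB : ∀ t, g t ≤ B)
    (hl : ∀ s t, |g s - g t| ≤ Λ * ∑ j, |s j - t j|)
    (hPQ : ∀ A : Set (Fin k → ℝ), MeasurableSet A →
      P A ≤ Q {x | ∃ y ∈ A, (∑ j, |x j - y j|) < e} + ENNReal.ofReal e) :
    ∫ t, g t ∂P ≤ ∫ t, g t ∂Q + Λ * e + B * e := by
  have hB0 : 0 ≤ B := (h0 0).trans (hB 0)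
  have hintg : ∀ (ν : Measure (Fin k → ℝ)) [IsProbabilityMeasure ν], Integrable g ν := by
    intro ν _
    refine Integrable.of_bound hg.aestronglyMeasurable B (Filter.Eventually.of_forall fun t => ?_)
    rw [Real.norm_eq_abs, abs_of_nonneg (h0 t)]; exact hB t
  have hg' : Integrable (fun t => g t + Λ * e) Q := (hintg Q).add (integrable_const _)
  have key : ∫⁻ t, ENNReal.ofReal (g t) ∂P ≤
      ∫⁻ t, ENNReal.ofReal (g t + Λ * e) ∂Q + ENNReal.ofReal (B * e) := by
    rw [lintegral_eq_lintegral_meas_lt P (Filter.Eventually.of_forall h0) hg.aemeasurable]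
    rw [lintegral_eq_lintegral_meas_lt Q (Filter.Eventually.of_forall fun t => by
      have := h0 t; have := mul_nonneg hΛ he.le; simp only [Pi.zero_apply]; linarith) (by fun_prop)]
    have e1 : ∫⁻ t in Ioi (0:ℝ), P {a | t < g a} = ∫⁻ t in Ioc (0:ℝ) B, P {a | t < g a} := by
      rw [← Ioc_union_Ioi_eq_Ioi hB0, lintegral_union measurableSet_Ioi (Ioc_disjoint_Ioi le_rfl)]
      have : ∫⁻ t in Ioi B, P {a | t < g a} = 0 := by
        rw [setLIntegral_congr_fun (g := fun _ => 0) measurableSet_Ioi]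
        · simp
        · intro t ht
          have : {a | t < g a} = ∅ := by
            ext a; simp only [mem_ofPred_eq, mem_empty_iff_false, iff_false, not_lt]
            exact (hB a).trans (le_of_lt ht)
          simp [this]
      rw [this, add_zero]
    rw [e1]
    calc ∫⁻ t in Ioc (0:ℝ) B, P {a | t < g a}
        ≤ ∫⁻ t in Ioc (0:ℝ) B, (Q {a | t < g a + Λ * e} + ENNReal.ofReal e) := by
          apply lintegral_mono
          intro t
          refine (hPQ _ (measurableSet_lt measurable_const hg.measurable)).trans ?_
          refine add_le_add (measure_mono ?_) le_rfl
          rintro x ⟨y, hy, hxy⟩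
          have h1 := hl x y
          have h2 : Λ * ∑ j, |x j - y j| ≤ Λ * e := mul_le_mul_of_nonneg_left hxy.le hΛ
          have h3 := (abs_le.1 (h1.trans h2)).1
          simp only [mem_ofPred_eq] at hy ⊢
          linarith
      _ = (∫⁻ t in Ioc (0:ℝ) B, Q {a | t < g a + Λ * e}) + ENNReal.ofReal (B * e) := by
          rw [lintegral_add_right _ measurable_const]
          simp only [lintegral_const, Measure.restrict_apply MeasurableSet.univ, univ_inter,
            Real.volume_Ioc, sub_zero]
          rw [← ENNReal.ofReal_mul he.le, mul_comm e B]
      _ ≤ _ := by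
          refine add_le_add (lintegral_mono_set Ioc_subset_Ioi_self) le_rfl
  rw [← ofReal_integral_eq_lintegral_ofReal (hintg P) (Filter.Eventually.of_forall h0),
    ← ofReal_integral_eq_lintegral_ofReal hg' (Filter.Eventually.of_forall fun t => by
      have := h0 t; have := mul_nonneg hΛ he.le; simp only [Pi.zero_apply]; linarith),
    ← ENNReal.ofReal_add (integral_nonneg fun t => by
      have := h0 t; have := mul_nonneg hΛ he.le; simp only [Pi.zero_apply]; linarith) (by positivity)] at key
  have hnn : 0 ≤ ∫ t, g t ∂Q := integral_nonneg h0
  rw [integral_add (hintg Q) (integrable_const _)] at key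
  rw [ENNReal.ofReal_le_ofReal_iff] at key
  · simpa using key
  · simp; positivity

/-- Prokhorov distance bounds the `ℓ1` distance of the signal distributions. -/
theorem signal_tv {k : ℕ} {K : Type} [Fintype K] (P Q : Measure (Fin k → ℝ))
    [IsProbabilityMeasure P] [IsProbabilityMeasure Q]
    (φ : K → (Fin k → ℝ) → ℝ) (hc : ∀ κ, Continuous (φ κ)) (h0 : ∀ κ t, 0 ≤ φ κ t)
    (h1 : ∀ t, ∑ κ, φ κ t = 1) (δ ε : ℝ) (hδ : 0 < δ) (hε : 0 < ε)
    (hl : ∀ s t, ∑ κ, |φ κ s - φ κ t| ≤ 2 / δ * ∑ j, |s j - t j|)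
    (hPQ : ProkhorovLe P Q ε) :
    ∑ κ, |∫ t, φ κ t ∂Q - ∫ t, φ κ t ∂P| ≤ 2 * ε / δ + 2 * ε := by
  classical
  have hle : ∀ κ t, φ κ t ≤ 1 := fun κ t => by
    rw [← h1 t]; exact Finset.single_le_sum (fun κ _ => h0 κ t) (Finset.mem_univ κ)
  have hintg : ∀ (ν : Measure (Fin k → ℝ)) [IsProbabilityMeasure ν] κ, Integrable (φ κ) ν := by
    intro ν _ κ
    refine Integrable.of_bound (hc κ).aestronglyMeasurable 1 (Filter.Eventually.of_forall fun t => ?_)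
    rw [Real.norm_eq_abs, abs_of_nonneg (h0 κ t)]; exact hle κ t
  have main : ∀ e, ε < e → ∑ κ, |∫ t, φ κ t ∂Q - ∫ t, φ κ t ∂P| ≤ 2 * e / δ + 2 * e := by
    intro e he
    let σ : K → ℝ := fun κ => if 0 ≤ ∫ t, φ κ t ∂Q - ∫ t, φ κ t ∂P then 1 else -1
    have hσ : ∀ κ, |σ κ| = 1 := by intro κ; simp only [σ]; split_ifs <;> simp
    have hσ2 : ∀ κ, |∫ t, φ κ t ∂Q - ∫ t, φ κ t ∂P| = σ κ * (∫ t, φ κ t ∂Q - ∫ t, φ κ t ∂P) := by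
      intro κ; simp only [σ]; split_ifs with h
      · rw [abs_of_nonneg h, one_mul]
      · rw [abs_of_neg (not_le.1 h)]; ring
    let g : (Fin k → ℝ) → ℝ := fun t => ∑ κ, σ κ * φ κ t + 1
    have habs : ∀ t, |∑ κ, σ κ * φ κ t| ≤ 1 := by
      intro t
      refine (Finset.abs_sum_le_sum_abs _ _).trans ?_
      rw [← h1 t]
      refine Finset.sum_le_sum fun κ _ => ?_
      rw [abs_mul, hσ, one_mul, abs_of_nonneg (h0 κ t)]
    have hgi : ∀ (ν : Measure (Fin k → ℝ)) [IsProbabilityMeasure ν],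
        ∫ t, g t ∂ν = ∑ κ, σ κ * ∫ t, φ κ t ∂ν + 1 := by
      intro ν _
      simp only [g]
      rw [integral_add (integrable_finsetSum _ fun κ _ => (hintg ν κ).const_mul _) (integrable_const _),
        integral_finsetSum _ fun κ _ => (hintg ν κ).const_mul _]
      simp [integral_const_mul]
    have := nhd_lintegral Q P g (by
        simp only [g]
        exact (continuous_finsetSum _ fun κ _ => (hc κ).const_smul (σ κ)).add continuous_const)
      2 (2 / δ) e (by positivity) (hε.trans he)
      (fun t => by have := (abs_le.1 (habs t)).1; simp only [g]; linarith)
      (fun t => by have := (abs_le.1 (habs t)).2; simp only [g]; linarith)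
      (fun s t => by
        refine le_trans ?_ (hl s t)
        simp only [g]
        rw [add_sub_add_right_eq_sub, ← Finset.sum_sub_distrib]
        refine (Finset.abs_sum_le_sum_abs _ _).trans (Finset.sum_le_sum fun κ _ => ?_)
        rw [← mul_sub, abs_mul, hσ, one_mul])
      (fun A hA => (hPQ e he A hA).2)
    rw [hgi, hgi] at this
    simp_rw [hσ2, mul_sub]
    rw [Finset.sum_sub_distrib]
    have e2 : 2 * e / δ = 2 / δ * e := by ring
    linarith
  have hcont : Filter.Tendsto (fun e : ℝ => 2 * e / δ + 2 * e) (nhdsWithin ε (Ioi ε))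
      (nhds (2 * ε / δ + 2 * ε)) := by
    apply Filter.Tendsto.mono_left _ nhdsWithin_le_nhds
    exact (Continuous.tendsto (by fun_prop) ε)
  exact ge_of_tendsto hcont (Filter.eventually_of_mem self_mem_nhdsWithin main)

namespace MultiItem

set_option linter.unusedSectionVars false

theorem measurable_some_opt {α : Type*} [MeasurableSpace α] : Measurable (some : α → Option α) :=
  fun _ hs => hs

theorem measurable_of_some {α β : Type*} [MeasurableSpace α] [MeasurableSpace β] {f : Option α → β}
    (h : Measurable fun a => f (some a)) : Measurable f := fun _ hs => h hs

/-- bid profile in which `i` bids `o` and the others bid their types. -/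
def upd {n m : ℕ} (i : Fin n) (o : Option (Fin m → ℝ)) (s : Fin n → Fin m → ℝ) :
    Fin n → Option (Fin m → ℝ) := fun j => if j = i then o else some (s j)

theorem measurable_upd {n m : ℕ} (i : Fin n) {α : Type*} [MeasurableSpace α]
    {f : α → Option (Fin m → ℝ)} {g : α → Fin n → Fin m → ℝ} (hf : Measurable f) (hg : Measurable g) :
    Measurable fun a => upd i (f a) (g a) := by
  refine measurable_pi_lambda _ fun j => ?_
  unfold upd
  by_cases h : j = i
  · simpa [h] using hf
  · simp only [h, if_false]
    exact measurable_some_opt.comp ((measurable_pi_apply j).comp hg)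

theorem alloc_le_one {n m : ℕ} (M : Mechanism n m) (b) (x) : M.allocProb b x ≤ 1 := by
  rw [← M.allocProb_sum_one b]
  exact Finset.single_le_sum (fun y _ => M.allocProb_nonneg b y) (Finset.mem_univ x)

theorem sum_prod_single {ι K : Type*} [Fintype ι] [DecidableEq ι] [Fintype K] (g : ι → K → ℝ) (i : ι)
    (h : ∀ j, j ≠ i → ∑ κ, g j κ = 1) (F : K → ℝ) :
    ∑ k : ι → K, (∏ j, g j (k j)) * F (k i) = ∑ κ, g i κ * F κ := by
  let g' : ι → K → ℝ := fun j κ => if j = i then g i κ * F κ else g j κ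
  have e : ∀ k : ι → K, (∏ j, g j (k j)) * F (k i) = ∏ j, g' j (k j) := by
    intro k
    rw [← Finset.mul_prod_erase _ _ (Finset.mem_univ i),
      ← Finset.mul_prod_erase _ (fun j => g' j (k j)) (Finset.mem_univ i)]
    have : ∏ j ∈ Finset.univ.erase i, g' j (k j) = ∏ j ∈ Finset.univ.erase i, g j (k j) := by
      refine Finset.prod_congr rfl fun j hj => ?_
      simp [g', Finset.ne_of_mem_erase hj]
    rw [this]
    simp only [g', if_true]; ring
  simp_rw [e]
  rw [← Fintype.prod_sum, ← Finset.mul_prod_erase _ _ (Finset.mem_univ i)]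
  rw [Finset.prod_eq_one]
  · simp [g']
  · intro j hj
    have hj := Finset.ne_of_mem_erase hj
    simp only [g', hj, if_false]
    exact h j hj

section signals

variable {n m : ℕ} {K : Type} [Fintype K] (φ : K → (Fin m → ℝ) → ℝ)
  (D : Fin n → Measure (Fin m → ℝ)) (o : Fin n → K → Option (Fin m → ℝ)) (M : Mechanism n m)

/-- mass of a cell. -/
noncomputable def mass (i : Fin n) (κ : K) : ℝ := ∫ t, φ κ t ∂(D i)

open Classical in
/-- resampling density. -/
noncomputable def wt (i : Fin n) (κ : K) (s : Fin m → ℝ) : ℝ :=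
  if mass φ D i κ = 0 then 1 else φ κ s / mass φ D i κ

open Classical in
/-- resampled bid. -/
noncomputable def tau (i : Fin n) (κ : K) (s : Fin m → ℝ) : Option (Fin m → ℝ) :=
  if mass φ D i κ = 0 then o i κ else some s

/-- allocation probabilities given the signals. -/
noncomputable def Aprob (k : Fin n → K) (x : Alloc n m) : ℝ :=
  ∫ s, (∏ j, wt φ D j (k j) (s j)) * M.allocProb (fun j => tau φ D o j (k j) (s j)) x ∂(Measure.pi D)

variable (hc : ∀ κ, Continuous (φ κ)) (h0 : ∀ κ t, 0 ≤ φ κ t) (h1 : ∀ t, ∑ κ, φ κ t = 1)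
  [∀ i, IsProbabilityMeasure (D i)]

include h0 h1 in
theorem phi_le_one (κ : K) (t) : φ κ t ≤ 1 := by
  rw [← h1 t]; exact Finset.single_le_sum (fun κ _ => h0 κ t) (Finset.mem_univ κ)

include hc h0 h1 in
theorem phi_integrable (i : Fin n) (κ : K) : Integrable (φ κ) (D i) := by
  refine Integrable.of_bound (hc κ).aestronglyMeasurable 1 (Filter.Eventually.of_forall fun t => ?_)
  rw [Real.norm_eq_abs, abs_of_nonneg (h0 κ t)]; exact phi_le_one φ h0 h1 κ t

include h0 in
theorem mass_nonneg (i : Fin n) (κ : K) : 0 ≤ mass φ D i κ := integral_nonneg (h0 κ)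

include hc h0 h1 in
theorem mass_sum (i : Fin n) : ∑ κ, mass φ D i κ = 1 := by
  unfold mass
  rw [← integral_finsetSum _ fun κ _ => phi_integrable φ D hc h0 h1 i κ]
  simp [h1]

include h0 in
theorem wt_nonneg (i : Fin n) (κ : K) (s) : 0 ≤ wt φ D i κ s := by
  unfold wt; split_ifs
  · exact zero_le_one
  · exact div_nonneg (h0 κ s) (mass_nonneg φ D h0 i κ)

include hc in
theorem wt_measurable (i : Fin n) (κ : K) : Measurable (wt φ D i κ) := by
  unfold wt; split_ifs
  · exact measurable_const
  · exact (hc κ).measurable.div_const _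

include hc h0 h1 in
theorem wt_integrable (i : Fin n) (κ : K) : Integrable (wt φ D i κ) (D i) := by
  unfold wt; split_ifs
  · exact integrable_const _
  · exact (phi_integrable φ D hc h0 h1 i κ).div_const _

theorem wt_integral (i : Fin n) (κ : K) : ∫ s, wt φ D i κ s ∂(D i) = 1 := by
  unfold wt; split_ifs with h
  · simp
  · rw [integral_div]; exact div_self h

omit [Fintype K] [∀ i, IsProbabilityMeasure (D i)] in
theorem tau_measurable (i : Fin n) (κ : K) : Measurable (tau φ D o i κ) := by
  unfold tau; split_ifs
  · exact measurable_const
  · exact measurable_some_opt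

omit [Fintype K] [∀ i, IsProbabilityMeasure (D i)] in
theorem tau_prof_measurable (k : Fin n → K) :
    Measurable fun s : Fin n → Fin m → ℝ => fun j => tau φ D o j (k j) (s j) :=
  measurable_pi_lambda _ fun j => (tau_measurable φ D o j (k j)).comp (measurable_pi_apply j)

include hc h0 h1 in
theorem wtprod_integrable (k : Fin n → K) :
    Integrable (fun s : Fin n → Fin m → ℝ => ∏ j, wt φ D j (k j) (s j)) (Measure.pi D) :=
  Integrable.fintype_prod_dep (f := fun j => wt φ D j (k j)) fun j => wt_integrable φ D hc h0 h1 j (k j)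

theorem integrable_mul_alloc {α : Type*} [MeasurableSpace α] {μ : Measure α} {f : α → ℝ}
    (hf : Integrable f μ) {b : α → Fin n → Option (Fin m → ℝ)} (hb : Measurable b) (x : Alloc n m) :
    Integrable (fun a => f a * M.allocProb (b a) x) μ := by
  refine hf.mul_bdd (c := 1) ((M.meas_allocProb x).comp hb).aestronglyMeasurable ?_
  refine Filter.Eventually.of_forall fun a => ?_
  rw [Real.norm_eq_abs, abs_of_nonneg (M.allocProb_nonneg _ _)]
  exact alloc_le_one M _ _

include h0 in
theorem Aprob_nonneg (k : Fin n → K) (x) : 0 ≤ Aprob φ D o M k x :=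
  integral_nonneg fun _ => mul_nonneg (Finset.prod_nonneg fun j _ => wt_nonneg φ D h0 j _ _)
    (M.allocProb_nonneg _ _)

include hc h0 h1 in
theorem Aprob_sum (k : Fin n → K) : ∑ x, Aprob φ D o M k x = 1 := by
  unfold Aprob
  rw [← integral_finsetSum _ fun x _ => integrable_mul_alloc M (wtprod_integrable φ D hc h0 h1 k)
    (tau_prof_measurable φ D o k) x]
  simp_rw [← Finset.mul_sum, M.allocProb_sum_one, mul_one]
  rw [integral_fintype_prod_eq_prod (fun j => wt φ D j (k j))]
  exact Finset.prod_eq_one fun j _ => wt_integral φ D j (k j)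

include hc h0 h1 in
theorem ae_phi_zero : ∀ᵐ s ∂(Measure.pi D), ∀ j κ, mass φ D j κ = 0 → φ κ (s j) = 0 := by
  rw [ae_all_iff]; intro j
  rw [ae_all_iff]; intro κ
  by_cases h : mass φ D j κ = 0
  · have h2 : ∀ᵐ t ∂(D j), φ κ t = 0 :=
      (integral_eq_zero_iff_of_nonneg (h0 κ) (phi_integrable φ D hc h0 h1 j κ)).1 h
    have := (measurePreserving_eval D j).quasiMeasurePreserving.ae h2
    filter_upwards [this] with s hs _
    exact hs
  · exact Filter.Eventually.of_forall fun s hs => absurd hs h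

theorem eval_integrable {i : Fin n} {f : (Fin m → ℝ) → ℝ} (hf : Integrable f (D i)) :
    Integrable (fun s : Fin n → Fin m → ℝ => f (s i)) (Measure.pi D) :=
  (measurePreserving_eval D i).integrable_comp_of_integrable hf

include hc h0 h1 in
theorem resample_integrable (i : Fin n) (κ : K) (f : Alloc n m → ℝ) :
    Integrable (fun s : Fin n → Fin m → ℝ =>
      wt φ D i κ (s i) * ∑ x, M.allocProb (upd i (tau φ D o i κ (s i)) s) x * f x) (Measure.pi D) := by
  simp_rw [Finset.mul_sum, ← mul_assoc]
  refine integrable_finsetSum _ fun x _ => Integrable.mul_const ?_ _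
  exact integrable_mul_alloc M (eval_integrable D (wt_integrable φ D hc h0 h1 i κ))
    (measurable_upd i ((tau_measurable φ D o i κ).comp (measurable_pi_apply i)) measurable_id) x

include hc h0 h1 in
theorem claim1 (i : Fin n) (q : Fin n → K → ℝ) (hq : ∀ j, j ≠ i → q j = mass φ D j)
    (f : K → Alloc n m → ℝ) :
    ∑ k : Fin n → K, (∏ j, q j (k j)) * ∑ x, Aprob φ D o M k x * f (k i) x =
      ∑ κ, q i κ * ∫ s, wt φ D i κ (s i) *
        ∑ x, M.allocProb (upd i (tau φ D o i κ (s i)) s) x * f κ x ∂(Measure.pi D) := by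
  have I1 : ∀ (k : Fin n → K) x, Integrable (fun s : Fin n → Fin m → ℝ =>
      (∏ j, wt φ D j (k j) (s j)) * M.allocProb (fun j => tau φ D o j (k j) (s j)) x) (Measure.pi D) :=
    fun k x => integrable_mul_alloc M (wtprod_integrable φ D hc h0 h1 k) (tau_prof_measurable φ D o k) x
  have E1 : ∀ k : Fin n → K, (∏ j, q j (k j)) * ∑ x, Aprob φ D o M k x * f (k i) x =
      ∫ s, (∏ j, q j (k j)) * ∑ x, (∏ j, wt φ D j (k j) (s j)) *
        M.allocProb (fun j => tau φ D o j (k j) (s j)) x * f (k i) x ∂(Measure.pi D) := by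
    intro k
    rw [integral_const_mul, integral_finsetSum _ fun x _ => (I1 k x).mul_const _]
    simp_rw [integral_mul_const]
    rfl
  simp_rw [E1, ← integral_const_mul]
  rw [← integral_finsetSum _ fun k _ =>
    (integrable_finsetSum _ fun x _ => (I1 k x).mul_const (f (k i) x)).const_mul _]
  rw [← integral_finsetSum _ fun κ _ => (resample_integrable φ D o M hc h0 h1 i κ (f κ)).const_mul _]
  apply integral_congr_ae
  filter_upwards [ae_phi_zero φ D hc h0 h1] with s hs
  let g : Fin n → K → ℝ := fun j κ => if j = i then q i κ * wt φ D i κ (s i) else φ κ (s j)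
  let F : K → ℝ := fun κ => ∑ x, M.allocProb (upd i (tau φ D o i κ (s i)) s) x * f κ x
  have e : ∀ k : Fin n → K, (∏ j, q j (k j)) * ∑ x, (∏ j, wt φ D j (k j) (s j)) *
        M.allocProb (fun j => tau φ D o j (k j) (s j)) x * f (k i) x = (∏ j, g j (k j)) * F (k i) := by
    intro k
    by_cases hz : ∃ j, j ≠ i ∧ mass φ D j (k j) = 0
    · obtain ⟨j, hj, hm⟩ := hz
      have z1 : q j (k j) = 0 := by rw [hq j hj, hm]
      have z2 : g j (k j) = 0 := by simp only [g, hj, if_false]; exact hs j _ hm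
      rw [Finset.prod_eq_zero (Finset.mem_univ j) z1,
        Finset.prod_eq_zero (f := fun j => g j (k j)) (Finset.mem_univ j) z2]
      simp
    · push Not at hz
      have hb : (fun j => tau φ D o j (k j) (s j)) = upd i (tau φ D o i (k i) (s i)) s := by
        funext j
        unfold upd
        by_cases hj : j = i
        · subst hj; simp
        · simp only [hj, if_false]; unfold tau; rw [if_neg (hz j hj)]
      rw [hb]
      simp_rw [mul_assoc, ← Finset.mul_sum]
      rw [← mul_assoc, ← Finset.prod_mul_distrib]
      congr 1
      refine Finset.prod_congr rfl fun j _ => ?_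
      by_cases hj : j = i
      · subst hj; simp [g]
      · simp only [g, hj, if_false]
        rw [hq j hj]; unfold wt; rw [if_neg (hz j hj)]
        have := hz j hj
        field_simp
  simp_rw [e]
  rw [sum_prod_single g i (fun j hj => by simp only [g, hj, if_false]; exact h1 _) F]
  refine Finset.sum_congr rfl fun κ _ => ?_
  simp only [g, if_true, F]; ring

end signals

end MultiItem

namespace MultiItem

set_option linter.unusedSectionVars false

theorem msupport_eq {m : ℕ} (μ : Measure (Fin m → ℝ)) : msupport μ = μ.support := by
  rw [Measure.support_eq_forall_isOpen]
  ext x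
  simp only [msupport, mem_ofPred_eq]
  exact forall_congr' fun U => ⟨fun h a b => h b a, fun h a b => h b a⟩

theorem ae_msupport {m : ℕ} (μ : Measure (Fin m → ℝ)) : ∀ᵐ t ∂μ, t ∈ msupport μ := by
  rw [msupport_eq]; exact Measure.support_mem_ae

theorem box_closed {m : ℕ} (H : ℝ) : IsClosed {t : Fin m → ℝ | ∀ j, t j ∈ Icc (0:ℝ) H} := by
  have : {t : Fin m → ℝ | ∀ j, t j ∈ Icc (0:ℝ) H} = ⋂ j, (fun t : Fin m → ℝ => t j) ⁻¹' Icc 0 H := by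
    ext t; simp
  rw [this]
  exact isClosed_iInter fun j => isClosed_Icc.preimage (continuous_apply j)

theorem ae_box {m : ℕ} {H : ℝ} (μ : Measure (Fin m → ℝ)) [IsProbabilityMeasure μ] (h : suppBox H μ) :
    ∀ᵐ t ∂μ, ∀ j, t j ∈ Icc (0:ℝ) H := by
  have := (prob_compl_eq_zero_iff (μ := μ) (box_closed H).measurableSet).2 h
  exact this

theorem msupport_box {m : ℕ} {H : ℝ} (μ : Measure (Fin m → ℝ)) [IsProbabilityMeasure μ]
    (h : suppBox H μ) {t : Fin m → ℝ} (ht : t ∈ msupport μ) : ∀ j, t j ∈ Icc (0:ℝ) H := by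
  rw [msupport_eq] at ht
  exact Measure.support_subset_of_isClosed (box_closed H) (ae_box μ h) ht

theorem ae_eval {n m : ℕ} (D : Fin n → Measure (Fin m → ℝ)) [∀ i, IsProbabilityMeasure (D i)]
    {i : Fin n} {p : (Fin m → ℝ) → Prop} (h : ∀ᵐ t ∂(D i), p t) : ∀ᵐ s ∂(Measure.pi D), p (s i) :=
  (measurePreserving_eval D i).quasiMeasurePreserving.ae h

theorem mp_update {n m : ℕ} (D : Fin n → Measure (Fin m → ℝ)) [∀ i, IsProbabilityMeasure (D i)]
    (i : Fin n) :
    MeasurePreserving (fun p : (Fin m → ℝ) × (Fin n → Fin m → ℝ) => Function.update p.2 i p.1)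
      ((D i).prod (Measure.pi D)) (Measure.pi D) := by
  have hm : Measurable (fun p : (Fin m → ℝ) × (Fin n → Fin m → ℝ) => Function.update p.2 i p.1) := by
    refine measurable_pi_lambda _ fun j => ?_
    by_cases h : j = i
    · subst h; simpa using measurable_fst
    · simp only [Function.update_of_ne h]
      exact (measurable_pi_apply j).comp measurable_snd
  refine ⟨hm, ?_⟩
  symm
  apply Measure.pi_eq
  intro S hS
  rw [Measure.map_apply hm (MeasurableSet.univ_pi hS)]
  have : (fun p : (Fin m → ℝ) × (Fin n → Fin m → ℝ) => Function.update p.2 i p.1) ⁻¹' (univ.pi S) =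
      S i ×ˢ (univ.pi (Function.update S i univ)) := by
    ext ⟨a, b⟩
    simp only [mem_preimage, mem_pi, mem_univ, forall_true_left, mem_prod]
    constructor
    · intro h
      refine ⟨by simpa using h i, fun j => ?_⟩
      by_cases hj : j = i
      · subst hj; simp
      · simpa [Function.update_of_ne hj] using h j
    · rintro ⟨h1, h2⟩ j
      by_cases hj : j = i
      · subst hj; simpa using h1
      · simpa [Function.update_of_ne hj] using h2 j
  rw [this, Measure.prod_prod, Measure.pi_pi, ← Finset.mul_prod_erase _ _ (Finset.mem_univ i),
    ← Finset.mul_prod_erase _ (fun j => D j (S j)) (Finset.mem_univ i)]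
  simp only [Function.update_self, measure_univ, one_mul]
  congr 1
  refine Finset.prod_congr rfl fun j hj => ?_
  rw [Function.update_of_ne (Finset.ne_of_mem_erase hj)]

theorem some_update {n m : ℕ} (i : Fin n) (σ : Fin m → ℝ) (s : Fin n → Fin m → ℝ) :
    (fun j => some (Function.update s i σ j)) = upd i (some σ) s := by
  funext j
  unfold upd
  by_cases h : j = i
  · subst h; simp
  · simp [h]

section interim

variable {n m : ℕ} {H L : ℝ} (v : Fin n → (Fin m → ℝ) → Alloc n m → ℝ) (M : Mechanism n m)
  (D : Fin n → Measure (Fin m → ℝ)) [∀ i, IsProbabilityMeasure (D i)]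

/-- expected value of a bidder of type `t` under bid profile `b`. -/
def val (i : Fin n) (t : Fin m → ℝ) (b : Fin n → Option (Fin m → ℝ)) : ℝ :=
  ∑ x, M.allocProb b x * v i t x

/-- good types. -/
def Good (i : Fin n) : Set (Fin m → ℝ) :=
  {σ | σ ∈ msupport (D i) ∧ Integrable (fun s => M.pay (upd i (some σ) s) i) (Measure.pi D)}

/-- good bids. -/
def GoodBid (i : Fin n) : Set (Option (Fin m → ℝ)) :=
  {o | o = none ∨ ∃ σ ∈ Good M D i, o = some σ}

/-- the indirect utility. -/
noncomputable def Wf (i : Fin n) (t : Fin m → ℝ) : ℝ :=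
  ⨆ o : GoodBid M D i, interim v M D i t o

theorem val_integrable {α : Type*} [MeasurableSpace α] {μ : Measure α} [IsFiniteMeasure μ]
    (f : Alloc n m → ℝ) {b : α → Fin n → Option (Fin m → ℝ)} (hb : Measurable b) :
    Integrable (fun a => ∑ x, M.allocProb (b a) x * f x) μ := by
  refine integrable_finsetSum _ fun x _ => Integrable.mul_const ?_ _
  simpa using integrable_mul_alloc M (integrable_const (1:ℝ)) hb x

theorem upd_none (i : Fin n) (s : Fin n → Fin m → ℝ) : ∃ j, upd i none s j = none := ⟨i, by simp [upd]⟩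

theorem pay_integrable {i : Fin n} {o : Option (Fin m → ℝ)} (ho : o ∈ GoodBid M D i) :
    Integrable (fun s => M.pay (upd i o s) i) (Measure.pi D) := by
  rcases ho with rfl | ⟨σ, hσ, rfl⟩
  · simp_rw [(M.optOut _ (upd_none i _)).2]; exact integrable_const _
  · exact hσ.2

theorem util_integrable {i : Fin n} (t : Fin m → ℝ) {o : Option (Fin m → ℝ)} (ho : o ∈ GoodBid M D i) :
    Integrable (fun s => util v M i t (upd i o s)) (Measure.pi D) :=
  (val_integrable M (v i t) (measurable_upd i measurable_const measurable_id)).sub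
    (pay_integrable M D ho)

theorem interim_sub {i : Fin n} (t t' : Fin m → ℝ) {o : Option (Fin m → ℝ)} (ho : o ∈ GoodBid M D i) :
    interim v M D i t o - interim v M D i t' o =
      ∫ s, ∑ x, M.allocProb (upd i o s) x * (v i t x - v i t' x) ∂(Measure.pi D) := by
  have := integral_sub (util_integrable v M D t ho) (util_integrable v M D t' ho)
  unfold interim
  refine this.symm.trans ?_
  congr 1
  funext s
  unfold util
  simp_rw [mul_sub]
  rw [Finset.sum_sub_distrib]; ring

theorem avg_abs_le (p f : Alloc n m → ℝ) (hp : ∀ x, 0 ≤ p x) (hp1 : ∑ x, p x = 1) {C : ℝ}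
    (hf : ∀ x, |f x| ≤ C) : |∑ x, p x * f x| ≤ C := by
  refine (Finset.abs_sum_le_sum_abs _ _).trans ?_
  calc ∑ x, |p x * f x| ≤ ∑ x, p x * C := Finset.sum_le_sum fun x _ => by
        rw [abs_mul, abs_of_nonneg (hp x)]; exact mul_le_mul_of_nonneg_left (hf x) (hp x)
    _ = C := by rw [← Finset.sum_mul, hp1, one_mul]

variable (hv : ∀ i t t' x, |v i t x - v i t' x| ≤ L * ∑ j, |t j - t' j|)

include hv in
theorem interim_lip {i : Fin n} (t t' : Fin m → ℝ) {o : Option (Fin m → ℝ)} (ho : o ∈ GoodBid M D i) :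
    interim v M D i t o - interim v M D i t' o ≤ L * ∑ j, |t j - t' j| := by
  rw [interim_sub v M D t t' ho]
  calc _ ≤ ∫ _ : Fin n → Fin m → ℝ, L * ∑ j, |t j - t' j| ∂(Measure.pi D) := by
        refine integral_mono (val_integrable M _ (measurable_upd i measurable_const measurable_id))
          (integrable_const _) fun s => ?_
        exact (le_abs_self _).trans (avg_abs_le _ _ (M.allocProb_nonneg _) (M.allocProb_sum_one _)
          fun x => hv i t t' x)
    _ = _ := by simp

theorem interim_none (i : Fin n) (t : Fin m → ℝ) : interim v M D i t none = v i t (emptyAlloc n m) := by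
  have : ∀ s : Fin n → Fin m → ℝ, util v M i t (upd i none s) = v i t (emptyAlloc n m) := by
    intro s
    obtain ⟨h1, h2⟩ := M.optOut _ (upd_none i s)
    unfold util; rw [h1, h2]; simp
  change ∫ s, util v M i t (upd i none s) ∂(Measure.pi D) = _
  simp_rw [this]; simp

theorem none_good (i : Fin n) : none ∈ GoodBid M D i := Or.inl rfl

variable (hbox : ∀ i, suppBox H (D i)) (hbic : IsBIC 0 H v M D)
  (hpay : ∀ i, Integrable (fun s => M.pay (fun j => some (s j)) i) (Measure.pi D))

include hbox in
theorem good_box {i : Fin n} {σ : Fin m → ℝ} (h : σ ∈ Good M D i) : ∀ j, σ j ∈ Icc (0:ℝ) H :=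
  msupport_box (D i) (hbox i) h.1

include hbox hbic in
theorem interim_le {i : Fin n} {σ : Fin m → ℝ} (hσ : σ ∈ Good M D i) {o : Option (Fin m → ℝ)}
    (ho : o ∈ GoodBid M D i) : interim v M D i σ o ≤ interim v M D i σ (some σ) := by
  have := hbic i σ hσ.1 o (by
    rcases ho with rfl | ⟨τ, hτ, rfl⟩
    · simp
    · intro s hs; simp only [Option.mem_def, Option.some.injEq] at hs; subst hs
      exact good_box M D hbox hτ)
  linarith

theorem pay_prod_integrable
    (hpay : ∀ i, Integrable (fun s => M.pay (fun j => some (s j)) i) (Measure.pi D)) (i : Fin n) :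
    Integrable (fun p : (Fin m → ℝ) × (Fin n → Fin m → ℝ) => M.pay (upd i (some p.1) p.2) i)
      ((D i).prod (Measure.pi D)) := by
  have := (mp_update D i).integrable_comp_of_integrable (hpay i)
  refine this.congr (Filter.Eventually.of_forall fun p => ?_)
  simp only [Function.comp]
  rw [some_update]

include hpay in
theorem ae_good (i : Fin n) : ∀ᵐ σ ∂(D i), σ ∈ Good M D i := by
  filter_upwards [ae_msupport (D i), (pay_prod_integrable M D hpay i).prod_right_ae] with σ h1 h2
  exact ⟨h1, h2⟩

include hpay in
theorem exists_good (i : Fin n) : ∃ σ, σ ∈ Good M D i := (ae_good M D hpay i).exists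

include hv hbox hbic hpay in
theorem interim_bdd (i : Fin n) (t : Fin m → ℝ) :
    BddAbove (range fun o : GoodBid M D i => interim v M D i t o) := by
  obtain ⟨σ, hσ⟩ := exists_good M D hpay i
  refine ⟨interim v M D i σ (some σ) + L * ∑ j, |t j - σ j|, ?_⟩
  rintro _ ⟨o, rfl⟩
  have h1 := interim_lip v M D hv t σ o.2
  have h2 := interim_le v M D hbox hbic hσ o.2
  simp only
  linarith

include hv hbox hbic hpay in
theorem le_Wf {i : Fin n} (t : Fin m → ℝ) {o : Option (Fin m → ℝ)} (ho : o ∈ GoodBid M D i) :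
    interim v M D i t o ≤ Wf v M D i t :=
  le_ciSup (interim_bdd v M D hv hbox hbic hpay i t) ⟨o, ho⟩

theorem exists_near (i : Fin n) (t : Fin m → ℝ) {η : ℝ} (hη : 0 < η) :
    ∃ o ∈ GoodBid M D i, Wf v M D i t < interim v M D i t o + η := by
  have : Nonempty (GoodBid M D i) := ⟨⟨none, none_good M D i⟩⟩
  obtain ⟨o, ho⟩ := exists_lt_of_lt_ciSup (show Wf v M D i t - η < ⨆ o : GoodBid M D i, interim v M D i t o by
    unfold Wf; linarith)
  exact ⟨o, o.2, by linarith⟩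

include hv hbox hbic hpay in
theorem Wf_lip (i : Fin n) (t t' : Fin m → ℝ) :
    Wf v M D i t - Wf v M D i t' ≤ L * ∑ j, |t j - t' j| := by
  have : Nonempty (GoodBid M D i) := ⟨⟨none, none_good M D i⟩⟩
  rw [sub_le_iff_le_add]
  refine ciSup_le fun o => ?_
  have h1 := interim_lip v M D hv t t' o.2
  have h2 := le_Wf v M D hv hbox hbic hpay t' o.2
  linarith

include hv hbox hbic hpay in
theorem Wf_abs (i : Fin n) (t t' : Fin m → ℝ) :
    |Wf v M D i t - Wf v M D i t'| ≤ L * ∑ j, |t j - t' j| := by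
  rw [abs_le]
  have h1 := Wf_lip v M D hv hbox hbic hpay i t t'
  have h2 := Wf_lip v M D hv hbox hbic hpay i t' t
  simp_rw [abs_sub_comm (t' _)] at h2
  constructor <;> linarith

include hv hbox hbic hpay in
theorem Wf_good {i : Fin n} {σ : Fin m → ℝ} (hσ : σ ∈ Good M D i) :
    Wf v M D i σ = interim v M D i σ (some σ) := by
  have : Nonempty (GoodBid M D i) := ⟨⟨none, none_good M D i⟩⟩
  apply le_antisymm
  · exact ciSup_le fun o => interim_le v M D hbox hbic hσ o.2
  · exact le_Wf v M D hv hbox hbic hpay σ (Or.inr ⟨σ, hσ, rfl⟩)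

theorem continuous_of_lip {f : (Fin m → ℝ) → ℝ} {C : ℝ} (h : ∀ t t', |f t - f t'| ≤ C * ∑ j, |t j - t' j|) :
    Continuous f := by
  rw [continuous_iff_continuousAt]
  intro t'
  rw [ContinuousAt, tendsto_iff_dist_tendsto_zero]
  have hc : Filter.Tendsto (fun t : Fin m → ℝ => C * ∑ j, |t j - t' j|) (nhds t') (nhds 0) := by
    have : Continuous (fun t : Fin m → ℝ => C * ∑ j, |t j - t' j|) := by fun_prop
    simpa using this.tendsto t'
  exact squeeze_zero (fun _ => dist_nonneg) (fun t => by rw [Real.dist_eq]; exact h t t') hc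

end interim

end MultiItem

namespace MultiItem

set_option linter.unusedSectionVars false

theorem upd_update {n m : ℕ} (i : Fin n) (o : Option (Fin m → ℝ)) (σ : Fin m → ℝ)
    (s : Fin n → Fin m → ℝ) : upd i o (Function.update s i σ) = upd i o s := by
  funext j
  unfold upd
  by_cases h : j = i
  · simp [h]
  · simp [h]

theorem upd_self {n m : ℕ} (i : Fin n) (s : Fin n → Fin m → ℝ) :
    upd i (some (s i)) s = fun j => some (s j) := by
  funext j
  unfold upd
  by_cases h : j = i
  · subst h; simp
  · simp [h]

theorem fubini_upd {n m : ℕ} (D : Fin n → Measure (Fin m → ℝ)) [∀ i, IsProbabilityMeasure (D i)]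
    (i : Fin n) {Φ : (Fin n → Fin m → ℝ) → ℝ} (hΦ : Integrable Φ (Measure.pi D)) :
    Integrable (fun σ => ∫ s, Φ (Function.update s i σ) ∂(Measure.pi D)) (D i) ∧
    ∫ s, Φ s ∂(Measure.pi D) = ∫ σ, ∫ s, Φ (Function.update s i σ) ∂(Measure.pi D) ∂(D i) := by
  have h1 := (mp_update D i).integrable_comp_of_integrable hΦ
  refine ⟨h1.integral_prod_left, ?_⟩
  have h2 := integral_prod _ h1
  rw [← (mp_update D i).map_eq, integral_map (mp_update D i).measurable.aemeasurable
    (by rw [(mp_update D i).map_eq]; exact hΦ.aestronglyMeasurable), (mp_update D i).map_eq]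
  exact h2

theorem l1_box {m : ℕ} {H : ℝ} {s t : Fin m → ℝ} (hs : ∀ j, s j ∈ Icc (0:ℝ) H)
    (ht : ∀ j, t j ∈ Icc (0:ℝ) H) : ∑ j, |s j - t j| ≤ m * H := by
  calc ∑ j, |s j - t j| ≤ ∑ _j : Fin m, H := Finset.sum_le_sum fun j _ => by
        rw [abs_le]; have := hs j; have := ht j; simp only [mem_Icc] at *; constructor <;> linarith
    _ = m * H := by simp

theorem lip_integrable {m : ℕ} {H C : ℝ} (hH : 0 < H) (hC : 0 ≤ C) (μ : Measure (Fin m → ℝ))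
    [IsProbabilityMeasure μ]
    (hb : suppBox H μ) {f : (Fin m → ℝ) → ℝ} (h : ∀ t t', |f t - f t'| ≤ C * ∑ j, |t j - t' j|) :
    Integrable f μ := by
  refine Integrable.of_bound (continuous_of_lip h).aestronglyMeasurable (|f 0| + C * (m * H)) ?_
  filter_upwards [ae_box μ hb] with t ht
  have h1 := h t 0
  have h2 : C * ∑ j, |t j - (0 : Fin m → ℝ) j| ≤ C * (m * H) :=
    mul_le_mul_of_nonneg_left (l1_box ht fun j => by simp [hH.le]) hC
  rw [Real.norm_eq_abs]
  have h3 := abs_sub_abs_le_abs_sub (f t) (f 0)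
  linarith

/-- difference of expectations under two product distributions of signals. -/
theorem weighted_diff {ι κ : Type*} [Fintype ι] [DecidableEq ι] [Fintype κ] (p q : ι → κ → ℝ)
    (hp : ∀ i k, 0 ≤ p i k) (hq : ∀ i k, 0 ≤ q i k)
    (hp1 : ∀ i, ∑ k, p i k = 1) (hq1 : ∀ i, ∑ k, q i k = 1) (τ : ℝ)
    (hτ : ∀ i, ∑ k, |p i k - q i k| ≤ τ) (F : (ι → κ) → ℝ) (C a : ℝ) (hC : 0 ≤ C)
    (hF : ∀ k, |F k + a| ≤ C) :
    |∑ k : ι → κ, (∏ i, p i (k i)) * F k - ∑ k : ι → κ, (∏ i, q i (k i)) * F k|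
      ≤ C * (Fintype.card ι * τ) := by
  have s1 : ∀ r : ι → κ → ℝ, (∀ i, ∑ k, r i k = 1) → ∑ k : ι → κ, ∏ i, r i (k i) = 1 := by
    intro r hr
    rw [← Fintype.prod_sum]; simp [hr]
  have e : ∑ k : ι → κ, (∏ i, p i (k i)) * F k - ∑ k : ι → κ, (∏ i, q i (k i)) * F k =
      ∑ k : ι → κ, (∏ i, p i (k i) - ∏ i, q i (k i)) * (F k + a) := by
    simp_rw [sub_mul, mul_add, Finset.sum_sub_distrib, Finset.sum_add_distrib, ← Finset.sum_mul,
      s1 p hp1, s1 q hq1]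
    ring
  rw [e]
  refine (Finset.abs_sum_le_sum_abs _ _).trans ?_
  calc ∑ k : ι → κ, |(∏ i, p i (k i) - ∏ i, q i (k i)) * (F k + a)|
      ≤ ∑ k : ι → κ, |∏ i, p i (k i) - ∏ i, q i (k i)| * C := by
        refine Finset.sum_le_sum fun k _ => ?_
        rw [abs_mul]; exact mul_le_mul_of_nonneg_left (hF k) (abs_nonneg _)
    _ = C * ∑ k : ι → κ, |∏ i, p i (k i) - ∏ i, q i (k i)| := by rw [← Finset.sum_mul, mul_comm]
    _ ≤ C * ∑ i, ∑ k, |p i k - q i k| := mul_le_mul_of_nonneg_left (prod_tv p q hp hq hp1 hq1) hC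
    _ ≤ C * ∑ _i : ι, τ := mul_le_mul_of_nonneg_left (Finset.sum_le_sum fun i _ => hτ i) hC
    _ = _ := by simp

section mech

variable {n m : ℕ} {K : Type} [Fintype K]

open Classical in
/-- allocation rule of the robust mechanism. -/
noncomputable def hatAlloc (φ : K → (Fin m → ℝ) → ℝ) (A : (Fin n → K) → Alloc n m → ℝ)
    (b : Fin n → Option (Fin m → ℝ)) (x : Alloc n m) : ℝ :=
  if ∃ i, b i = none then (if x = emptyAlloc n m then 1 else 0)
  else ∑ k : Fin n → K, (∏ j, φ (k j) ((b j).getD 0)) * A k x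

open Classical in
/-- payment rule of the robust mechanism. -/
noncomputable def hatPay (φ : K → (Fin m → ℝ) → ℝ) (A : (Fin n → K) → Alloc n m → ℝ)
    (v : Fin n → (Fin m → ℝ) → Alloc n m → ℝ) (W : Fin n → (Fin m → ℝ) → ℝ)
    (b : Fin n → Option (Fin m → ℝ)) (i : Fin n) : ℝ :=
  if ∃ i, b i = none then 0
  else ∑ x, hatAlloc φ A b x * v i ((b i).getD 0) x - W i ((b i).getD 0)

theorem meas_none : MeasurableSet {b : Fin n → Option (Fin m → ℝ) | ∃ i, b i = none} := by
  have : {b : Fin n → Option (Fin m → ℝ) | ∃ i, b i = none} = ⋃ i, (fun b => b i) ⁻¹' {none} := by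
    ext b; simp
  rw [this]
  refine MeasurableSet.iUnion fun i => (measurable_pi_apply i) ?_
  change MeasurableSet ((some : (Fin m → ℝ) → _) ⁻¹' {none})
  have : (some : (Fin m → ℝ) → _) ⁻¹' {none} = ∅ := by ext; simp
  rw [this]; exact MeasurableSet.empty

theorem meas_getD (i : Fin n) : Measurable fun b : Fin n → Option (Fin m → ℝ) => (b i).getD 0 := by
  have : Measurable fun o : Option (Fin m → ℝ) => o.getD 0 := measurable_of_some measurable_id
  exact this.comp (measurable_pi_apply i)

theorem meas_hatAlloc (φ : K → (Fin m → ℝ) → ℝ) (hc : ∀ κ, Continuous (φ κ))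
    (A : (Fin n → K) → Alloc n m → ℝ) (x : Alloc n m) : Measurable fun b => hatAlloc φ A b x := by
  unfold hatAlloc
  refine Measurable.ite meas_none measurable_const ?_
  refine Finset.measurable_fun_sum _ fun k _ => Measurable.mul_const ?_ _
  exact Finset.measurable_fun_prod _ fun j _ => (hc (k j)).measurable.comp (meas_getD j)

/-- the robust mechanism. -/
noncomputable def hatMech (φ : K → (Fin m → ℝ) → ℝ) (A : (Fin n → K) → Alloc n m → ℝ)
    (v : Fin n → (Fin m → ℝ) → Alloc n m → ℝ) (W : Fin n → (Fin m → ℝ) → ℝ)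
    (hc : ∀ κ, Continuous (φ κ)) (h0 : ∀ κ t, 0 ≤ φ κ t) (h1 : ∀ t, ∑ κ, φ κ t = 1)
    (hA0 : ∀ k x, 0 ≤ A k x) (hA1 : ∀ k, ∑ x, A k x = 1)
    (hv : ∀ i x, Continuous fun t => v i t x) (hW : ∀ i, Continuous (W i)) : Mechanism n m where
  allocProb := hatAlloc φ A
  pay := hatPay φ A v W
  allocProb_nonneg b x := by
    unfold hatAlloc
    split_ifs
    · exact zero_le_one
    · exact le_rfl
    · exact Finset.sum_nonneg fun k _ => mul_nonneg (Finset.prod_nonneg fun j _ => h0 _ _) (hA0 _ _)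
  allocProb_sum_one b := by
    unfold hatAlloc
    split_ifs
    · simp
    · rw [Finset.sum_comm]
      simp_rw [← Finset.mul_sum, hA1, mul_one]
      rw [← Fintype.prod_sum (fun (j : Fin n) κ => φ κ ((b j).getD 0))]
      simp [h1]
  optOut b hb := by
    constructor
    · funext x; unfold hatAlloc; rw [if_pos hb]
    · funext i; unfold hatPay; rw [if_pos hb]
  meas_allocProb x := meas_hatAlloc φ hc A x
  meas_pay i := by
    unfold hatPay
    refine Measurable.ite meas_none measurable_const ?_
    refine Measurable.sub ?_ ((hW i).measurable.comp (meas_getD i))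
    exact Finset.measurable_fun_sum _ fun x _ => (meas_hatAlloc φ hc A x).mul
      ((hv i x).measurable.comp (meas_getD i))

theorem hatAlloc_some (φ : K → (Fin m → ℝ) → ℝ) (A : (Fin n → K) → Alloc n m → ℝ)
    (s : Fin n → Fin m → ℝ) (x : Alloc n m) :
    hatAlloc φ A (fun j => some (s j)) x = ∑ k : Fin n → K, (∏ j, φ (k j) (s j)) * A k x := by
  unfold hatAlloc; rw [if_neg (by simp)]; simp

theorem hatPay_some (φ : K → (Fin m → ℝ) → ℝ) (A : (Fin n → K) → Alloc n m → ℝ)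
    (v : Fin n → (Fin m → ℝ) → Alloc n m → ℝ) (W : Fin n → (Fin m → ℝ) → ℝ)
    (s : Fin n → Fin m → ℝ) (i : Fin n) :
    hatPay φ A v W (fun j => some (s j)) i =
      ∑ x, hatAlloc φ A (fun j => some (s j)) x * v i (s i) x - W i (s i) := by
  unfold hatPay; rw [if_neg (by simp)]; simp

theorem hatAlloc_avg (φ : K → (Fin m → ℝ) → ℝ) (A : (Fin n → K) → Alloc n m → ℝ)
    (s : Fin n → Fin m → ℝ) (f : Alloc n m → ℝ) :
    ∑ x, hatAlloc φ A (fun j => some (s j)) x * f x =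
      ∑ k : Fin n → K, (∏ j, φ (k j) (s j)) * ∑ x, A k x * f x := by
  simp_rw [hatAlloc_some, Finset.sum_mul, Finset.mul_sum]
  rw [Finset.sum_comm]
  simp_rw [mul_assoc]

end mech

end MultiItem

namespace MultiItem

set_option linter.unusedSectionVars false

section core

variable {n m : ℕ} {K : Type} [Fintype K] {H L r η τ : ℝ} (φ : K → (Fin m → ℝ) → ℝ) (c : K → Fin m → ℝ)
  (v : Fin n → (Fin m → ℝ) → Alloc n m → ℝ) (M : Mechanism n m)
  (D : Fin n → Measure (Fin m → ℝ)) [∀ i, IsProbabilityMeasure (D i)]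
  (o : Fin n → K → Option (Fin m → ℝ))
  (hH : 0 < H) (hL : 0 < L) (hη : 0 ≤ η)
  (hc : ∀ κ, Continuous (φ κ)) (h0 : ∀ κ t, 0 ≤ φ κ t) (h1 : ∀ t, ∑ κ, φ κ t = 1)
  (hcb : ∀ κ j, c κ j ∈ Icc (0:ℝ) H)
  (hloc : ∀ κ s t, (∀ j, s j ∈ Icc (0:ℝ) H) → (∀ j, t j ∈ Icc (0:ℝ) H) → φ κ s ≠ 0 → φ κ t ≠ 0 →
        ∑ j, |s j - t j| ≤ r)
  (hlc : ∀ κ t, (∀ j, t j ∈ Icc (0:ℝ) H) → φ κ t ≠ 0 → ∑ j, |t j - c κ j| ≤ r)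
  (hv : ∀ i t t' x, |v i t x - v i t' x| ≤ L * ∑ j, |t j - t' j|)
  (hv0 : ∀ i t x, (∀ j, t j ∈ Icc (0:ℝ) H) → 0 ≤ v i t x)
  (hvB : ∀ i t x, (∀ j, t j ∈ Icc (0:ℝ) H) → v i t x ≤ m * L * H)
  (hbox : ∀ i, suppBox H (D i)) (hbic : IsBIC 0 H v M D)
  (hpay : ∀ i, Integrable (fun s => M.pay (fun j => some (s j)) i) (Measure.pi D))
  (hog : ∀ i κ, o i κ ∈ GoodBid M D i)
  (hon : ∀ i κ, Wf v M D i (c κ) ≤ interim v M D i (c κ) (o i κ) + η)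

include hL hη hc h0 h1 hloc hlc hv hbox hbic hpay hog hon in
theorem claim2 (i : Fin n) (t t' : Fin m → ℝ) 
    (ht' : ∀ j, t' j ∈ Icc (0:ℝ) H) (κ : K) (hκ : φ κ t' ≠ 0) :
    ∫ s, wt φ D i κ (s i) * ∑ x, M.allocProb (upd i (tau φ D o i κ (s i)) s) x * (v i t x - v i t' x)
      ∂(Measure.pi D) ≤ Wf v M D i t - Wf v M D i t' + (2 * (L * r) + η) := by
  by_cases hm : mass φ D i κ = 0
  · have e1 : ∀ s, wt φ D i κ s = 1 := fun s => by unfold wt; rw [if_pos hm]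
    have e2 : ∀ s, tau φ D o i κ s = o i κ := fun s => by unfold tau; rw [if_pos hm]
    simp_rw [e1, e2, one_mul]
    rw [← interim_sub v M D t t' (hog i κ)]
    have a1 := le_Wf v M D hv hbox hbic hpay t (hog i κ)
    have a2 := Wf_lip v M D hv hbox hbic hpay i t' (c κ)
    have a3 := interim_lip v M D hv (c κ) t' (hog i κ)
    have a4 := hon i κ
    have a5 : L * ∑ j, |t' j - c κ j| ≤ L * r := mul_le_mul_of_nonneg_left (hlc κ t' ht' hκ) hL.le
    simp_rw [abs_sub_comm (c κ _)] at a3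
    linarith
  · have e2 : ∀ s, tau φ D o i κ s = some s := fun s => by unfold tau; rw [if_neg hm]
    have hintg := resample_integrable φ D o M hc h0 h1 i κ (fun x => v i t x - v i t' x)
    simp_rw [e2] at hintg ⊢
    obtain ⟨f1, f2⟩ := fubini_upd D i hintg
    rw [f2]
    simp only [Function.update_self, upd_update] at f1 ⊢
    set C := Wf v M D i t - Wf v M D i t' + (2 * (L * r) + η)
    calc _ ≤ ∫ σ, wt φ D i κ σ * C ∂(D i) := by
          refine integral_mono_ae f1 ((wt_integrable φ D hc h0 h1 i κ).mul_const _) ?_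
          filter_upwards [ae_good M D hpay i] with σ hσ
          rw [integral_const_mul]
          by_cases hw : wt φ D i κ σ = 0
          · rw [hw]; simp
          refine mul_le_mul_of_nonneg_left ?_ (wt_nonneg φ D h0 i κ σ)
          have hφ : φ κ σ ≠ 0 := by
            intro h; apply hw; unfold wt; rw [if_neg hm, h, zero_div]
          have hg : some σ ∈ GoodBid M D i := Or.inr ⟨σ, hσ, rfl⟩
          rw [← interim_sub v M D t t' hg]
          have a1 := le_Wf v M D hv hbox hbic hpay t hg
          have a2 := Wf_lip v M D hv hbox hbic hpay i t' σ
          have a3 := interim_lip v M D hv σ t' hg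
          have a4 := Wf_good v M D hv hbox hbic hpay hσ
          have a5 : L * ∑ j, |t' j - σ j| ≤ L * r :=
            mul_le_mul_of_nonneg_left (hloc κ t' σ ht' (good_box M D hbox hσ) hκ hφ) hL.le
          simp_rw [abs_sub_comm (σ _)] at a3
          simp only [C]
          linarith
      _ = C := by rw [integral_mul_const, wt_integral, one_mul]

variable (E : Fin n → Measure (Fin m → ℝ)) [∀ i, IsProbabilityMeasure (E i)]
  (hEbox : ∀ i, suppBox H (E i))
  (hτ : ∀ i, ∑ κ, |mass φ E i κ - mass φ D i κ| ≤ τ)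

/-- the constructed mechanism. -/
noncomputable def robust : Mechanism n m :=
  hatMech φ (Aprob φ D o M) v (Wf v M D) hc h0 h1 (Aprob_nonneg φ D o M h0)
    (Aprob_sum φ D o M hc h0 h1) (fun i x => continuous_of_lip fun t t' => hv i t t' x)
    (fun i => continuous_of_lip (Wf_abs v M D hv hbox hbic hpay i))

theorem robust_alloc : (robust φ v M D o hc h0 h1 hv hbox hbic hpay).allocProb =
    hatAlloc φ (Aprob φ D o M) := rfl

theorem robust_pay : (robust φ v M D o hc h0 h1 hv hbox hbic hpay).pay =
    hatPay φ (Aprob φ D o M) v (Wf v M D) := rfl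

theorem robust_util (i : Fin n) (t : Fin m → ℝ) (s : Fin n → Fin m → ℝ) :
    util v (robust φ v M D o hc h0 h1 hv hbox hbic hpay) i t (fun j => some (s j)) =
      ∑ k : Fin n → K, (∏ j, φ (k j) (s j)) * ∑ x, Aprob φ D o M k x * (v i t x - v i (s i) x)
        + Wf v M D i (s i) := by
  unfold util
  rw [robust_alloc, robust_pay, hatPay_some, hatAlloc_avg, hatAlloc_avg]
  simp_rw [mul_sub, Finset.sum_sub_distrib, mul_sub, Finset.sum_sub_distrib]
  ring

theorem robust_util_true (i : Fin n) (s : Fin n → Fin m → ℝ) :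
    util v (robust φ v M D o hc h0 h1 hv hbox hbic hpay) i (s i) (fun j => some (s j)) =
      Wf v M D i (s i) := by
  rw [robust_util]; simp

include hv0 in
theorem robust_IR : IsIR H v (robust φ v M D o hc h0 h1 hv hbox hbic hpay) := by
  intro t ht i
  rw [robust_util_true]
  have := le_Wf v M D hv hbox hbic hpay (t i) (none_good M D i)
  rw [interim_none] at this
  exact (hv0 i (t i) _ (ht i)).trans this

include hc h0 h1 in
theorem phi_prod_integrable (k : Fin n → K) :
    Integrable (fun s : Fin n → Fin m → ℝ => ∏ j, φ (k j) (s j)) (Measure.pi E) :=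
  Integrable.fintype_prod_dep (f := fun j => φ (k j)) fun j => phi_integrable φ E hc h0 h1 j (k j)

include hH hL hη hloc hlc hvB hv0 hog hon hEbox hτ in
theorem robust_BIC : IsBIC (m * L * H * (n * τ) + (2 * (L * r) + η)) H v
    (robust φ v M D o hc h0 h1 hv hbox hbic hpay) E := by
  intro i t ht bid hbid
  have htb := msupport_box (E i) (hEbox i) ht
  have hB : 0 ≤ m * L * H := by positivity
  have hτ0 : 0 ≤ τ := (Finset.sum_nonneg fun κ _ => abs_nonneg _).trans (hτ i)
  set R := robust φ v M D o hc h0 h1 hv hbox hbic hpay with hR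
  -- interim utility of a type bid
  have hmis : ∀ t', interim v R E i t (some t') =
      ∑ k : Fin n → K, (∏ j, (if j = i then fun κ => φ κ t' else mass φ E j) (k j)) *
        ∑ x, Aprob φ D o M k x * (v i t x - v i t' x) + Wf v M D i t' := by
    intro t'
    change ∫ b, util v R i t (upd i (some t') b) ∂(Measure.pi E) = _
    simp_rw [← some_update, hR, robust_util, Function.update_self]
    let g : (Fin n → K) → Fin n → (Fin m → ℝ) → ℝ := fun k j s => if j = i then φ (k i) t' else φ (k j) s
    have e : ∀ (k : Fin n → K) (b : Fin n → Fin m → ℝ),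
        ∏ j, φ (k j) (Function.update b i t' j) = ∏ j, g k j (b j) := by
      intro k b
      refine Finset.prod_congr rfl fun j _ => ?_
      by_cases hj : j = i
      · subst hj; simp [g]
      · simp [g, hj]
    have gi : ∀ k, Integrable (fun b : Fin n → Fin m → ℝ => ∏ j, g k j (b j)) (Measure.pi E) := by
      intro k
      refine Integrable.fintype_prod_dep (f := g k) fun j => ?_
      by_cases hj : j = i
      · simp only [g, hj, if_true]; exact integrable_const _
      · simp only [g, hj, if_false]; exact phi_integrable φ E hc h0 h1 j (k j)
    simp_rw [e]
    rw [integral_add (integrable_finsetSum _ fun k _ => (gi k).mul_const _) (integrable_const _),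
      integral_finsetSum _ fun k _ => (gi k).mul_const _]
    simp_rw [integral_mul_const]
    simp only [integral_const, probReal_univ, smul_eq_mul, one_mul]
    congr 1
    refine Finset.sum_congr rfl fun k _ => ?_
    rw [integral_fintype_prod_eq_prod (g k)]
    congr 1
    refine Finset.prod_congr rfl fun j _ => ?_
    by_cases hj : j = i
    · subst hj; simp [g]
    · simp only [g, hj, if_false]; rfl
  have htrue : interim v R E i t (some t) = Wf v M D i t := by
    rw [hmis]; simp
  rw [htrue]
  rcases bid with _ | t'
  · rw [interim_none]
    have := le_Wf v M D hv hbox hbic hpay t (none_good M D i)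
    rw [interim_none] at this
    have h2 : 0 ≤ L * r := by
      have hne : ∃ κ, φ κ t ≠ 0 := by
        by_contra hcon
        push Not at hcon
        have := h1 t
        simp [hcon] at this
      obtain ⟨κ, hκ⟩ := hne
      exact mul_nonneg hL.le ((Finset.sum_nonneg fun j _ => abs_nonneg _).trans (hlc κ t htb hκ))
    have h3 : 0 ≤ m * L * H * (n * τ) := by positivity
    linarith
  · have ht' : ∀ j, t' j ∈ Icc (0:ℝ) H := hbid t' rfl
    rw [hmis]
    have hF : ∀ k : Fin n → K, |∑ x, Aprob φ D o M k x * (v i t x - v i t' x) + 0| ≤ m * L * H := by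
      intro k
      rw [add_zero]
      refine avg_abs_le _ _ (Aprob_nonneg φ D o M h0 k) (Aprob_sum φ D o M hc h0 h1 k) fun x => ?_
      have := hv0 i t x htb; have := hvB i t x htb; have := hv0 i t' x ht'; have := hvB i t' x ht'
      rw [abs_le]; constructor <;> linarith
    have wd := weighted_diff (ι := Fin n) (κ := K)
      (fun j => if j = i then fun κ => φ κ t' else mass φ E j)
      (fun j => if j = i then fun κ => φ κ t' else mass φ D j)
      (fun j κ => by split_ifs; exacts [h0 _ _, mass_nonneg φ E h0 _ _])
      (fun j κ => by split_ifs; exacts [h0 _ _, mass_nonneg φ D h0 _ _])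
      (fun j => by split_ifs; exacts [h1 _, mass_sum φ E hc h0 h1 _])
      (fun j => by split_ifs; exacts [h1 _, mass_sum φ D hc h0 h1 _]) τ
      (fun j => by split_ifs; exacts [by simpa using hτ0, hτ j])
      (fun k => ∑ x, Aprob φ D o M k x * (v i t x - v i t' x)) (m * L * H) 0 hB hF
    have c1 := claim1 φ D o M hc h0 h1 i (fun j => if j = i then fun κ => φ κ t' else mass φ D j)
      (fun j hj => by simp [hj]) (fun _ x => v i t x - v i t' x)
    simp only [if_true] at c1
    have c2 : ∑ κ, φ κ t' * ∫ s, wt φ D i κ (s i) *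
        ∑ x, M.allocProb (upd i (tau φ D o i κ (s i)) s) x * (v i t x - v i t' x) ∂(Measure.pi D) ≤
        ∑ κ, φ κ t' * (Wf v M D i t - Wf v M D i t' + (2 * (L * r) + η)) := by
      refine Finset.sum_le_sum fun κ _ => ?_
      by_cases hκ : φ κ t' = 0
      · simp [hκ]
      · exact mul_le_mul_of_nonneg_left (claim2 φ c v M D o hL hη hc h0 h1 hloc hlc hv hbox hbic hpay
          hog hon i t t' ht' κ hκ) (h0 κ t')
    rw [← Finset.sum_mul, h1, one_mul] at c2
    have wd2 := (abs_le.1 wd).2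
    simp only [Fintype.card_fin] at wd2
    linarith

end core

end MultiItem

namespace MultiItem

set_option linter.unusedSectionVars false

section revenue

variable {n m : ℕ} {K : Type} [Fintype K] {H L r τ : ℝ} (φ : K → (Fin m → ℝ) → ℝ) (c : K → Fin m → ℝ)
  (v : Fin n → (Fin m → ℝ) → Alloc n m → ℝ) (M : Mechanism n m)
  (D : Fin n → Measure (Fin m → ℝ)) [∀ i, IsProbabilityMeasure (D i)]
  (o : Fin n → K → Option (Fin m → ℝ))
  (hH : 0 < H) (hL : 0 < L)
  (hc : ∀ κ, Continuous (φ κ)) (h0 : ∀ κ t, 0 ≤ φ κ t) (h1 : ∀ t, ∑ κ, φ κ t = 1)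
  (hcb : ∀ κ j, c κ j ∈ Icc (0:ℝ) H)
  (hlc : ∀ κ t, (∀ j, t j ∈ Icc (0:ℝ) H) → φ κ t ≠ 0 → ∑ j, |t j - c κ j| ≤ r)
  (hv : ∀ i t t' x, |v i t x - v i t' x| ≤ L * ∑ j, |t j - t' j|)
  (hv0 : ∀ i t x, (∀ j, t j ∈ Icc (0:ℝ) H) → 0 ≤ v i t x)
  (hvB : ∀ i t x, (∀ j, t j ∈ Icc (0:ℝ) H) → v i t x ≤ m * L * H)
  (hbox : ∀ i, suppBox H (D i)) (hbic : IsBIC 0 H v M D)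
  (hpay : ∀ i, Integrable (fun s => M.pay (fun j => some (s j)) i) (Measure.pi D))

theorem meas_some_profile : Measurable fun (s : Fin n → Fin m → ℝ) (j : Fin n) => some (s j) :=
  measurable_pi_lambda _ fun j => measurable_some_opt.comp (measurable_pi_apply j)

include hL hlc hv hbox hbic hpay in
/-- comparing virtual payments at a type with those at the centre of its signal. -/
theorem h_lip (i : Fin n) (κ : K) (t : Fin m → ℝ) (ht : ∀ j, t j ∈ Icc (0:ℝ) H) (hκ : φ κ t ≠ 0)
    (p : Alloc n m → ℝ) (hp : ∀ x, 0 ≤ p x) (hp1 : ∑ x, p x = 1) :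
    |∑ x, p x * (v i t x - Wf v M D i t) - ∑ x, p x * (v i (c κ) x - Wf v M D i (c κ))|
      ≤ 2 * (L * r) := by
  rw [← Finset.sum_sub_distrib]
  simp_rw [← mul_sub]
  refine avg_abs_le p _ hp hp1 fun x => ?_
  have a1 := abs_le.1 (hv i t (c κ) x)
  have a2 := abs_le.1 (Wf_abs v M D hv hbox hbic hpay i t (c κ))
  have a3 : L * ∑ j, |t j - c κ j| ≤ L * r := mul_le_mul_of_nonneg_left (hlc κ t ht hκ) hL.le
  rw [abs_le]
  constructor <;> linarith [a1.1, a1.2, a2.1, a2.2]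

include hH hL hv hbox hbic hpay in
/-- the revenue of the original mechanism in terms of values and indirect utilities. -/
theorem rev_orig (i : Fin n) :
    Integrable (fun s : Fin n → Fin m → ℝ => ∑ x, M.allocProb (fun j => some (s j)) x *
      (v i (s i) x - Wf v M D i (s i))) (Measure.pi D) ∧
    ∫ s, ∑ x, M.allocProb (fun j => some (s j)) x * (v i (s i) x - Wf v M D i (s i)) ∂(Measure.pi D)
      = ∫ s, M.pay (fun j => some (s j)) i ∂(Measure.pi D) := by
  have iv : Integrable (fun s : Fin n → Fin m → ℝ => ∑ x, M.allocProb (fun j => some (s j)) x *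
      v i (s i) x) (Measure.pi D) := by
    refine integrable_finsetSum _ fun x _ => ?_
    simp_rw [mul_comm (M.allocProb _ _)]
    exact integrable_mul_alloc M (f := fun s : Fin n → Fin m → ℝ => v i (s i) x)
      (eval_integrable D (i := i) (f := fun t => v i t x) (lip_integrable hH hL.le (D i) (hbox i) fun t t' => hv i t t' x))
      meas_some_profile x
  have iw : Integrable (fun s : Fin n → Fin m → ℝ => Wf v M D i (s i)) (Measure.pi D) :=
    eval_integrable D (lip_integrable hH hL.le (D i) (hbox i) (Wf_abs v M D hv hbox hbic hpay i))
  have e : (fun s : Fin n → Fin m → ℝ => ∑ x, M.allocProb (fun j => some (s j)) x *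
      (v i (s i) x - Wf v M D i (s i))) = fun s => (∑ x, M.allocProb (fun j => some (s j)) x *
      v i (s i) x) - Wf v M D i (s i) := by
    funext s
    simp_rw [mul_sub, Finset.sum_sub_distrib, ← Finset.sum_mul, M.allocProb_sum_one, one_mul]
  rw [e]
  refine ⟨iv.sub iw, ?_⟩
  rw [integral_sub iv iw]
  have iu : Integrable (fun s : Fin n → Fin m → ℝ => util v M i (s i) (fun j => some (s j)))
      (Measure.pi D) := iv.sub (hpay i)
  have key : ∫ s, Wf v M D i (s i) ∂(Measure.pi D) =
      ∫ s, util v M i (s i) (fun j => some (s j)) ∂(Measure.pi D) := by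
    rw [(fubini_upd D i iu).2, (fubini_upd D i iw).2]
    refine integral_congr_ae ?_
    filter_upwards [ae_good M D hpay i] with σ hσ
    simp only [Function.update_self, integral_const, probReal_univ, smul_eq_mul, one_mul]
    rw [Wf_good v M D hv hbox hbic hpay hσ]
    simp_rw [some_update]
    rfl
  rw [key]
  unfold util
  rw [integral_sub iv (hpay i)]
  ring

include hH hL hc h0 h1 hlc hv hbox hbic hpay in
theorem rev_D (i : Fin n) :
    ∫ s, M.pay (fun j => some (s j)) i ∂(Measure.pi D) - 2 * (L * r) ≤
      ∑ k : Fin n → K, (∏ j, mass φ D j (k j)) *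
        ∑ x, Aprob φ D o M k x * (v i (c (k i)) x - Wf v M D i (c (k i))) := by
  rw [claim1 φ D o M hc h0 h1 i (mass φ D) (fun _ _ => rfl)
    (fun κ x => v i (c κ) x - Wf v M D i (c κ))]
  simp_rw [← integral_const_mul]
  rw [← integral_finsetSum _ fun κ _ => (resample_integrable φ D o M hc h0 h1 i κ _).const_mul _]
  obtain ⟨i1, e1⟩ := rev_orig v M D hH hL hv hbox hbic hpay i
  have e2 : ∫ s, M.pay (fun j => some (s j)) i ∂(Measure.pi D) - 2 * (L * r) =
      ∫ s, (∑ x, M.allocProb (fun j => some (s j)) x * (v i (s i) x - Wf v M D i (s i))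
        - 2 * (L * r)) ∂(Measure.pi D) := by
    rw [integral_sub i1 (integrable_const _), e1]; simp
  rw [e2]
  refine integral_mono_ae (i1.sub (integrable_const _)) (integrable_finsetSum _ fun κ _ =>
    (resample_integrable φ D o M hc h0 h1 i κ _).const_mul _) ?_
  filter_upwards [ae_phi_zero φ D hc h0 h1, ae_eval D (ae_box (D i) (hbox i))] with s hs hb
  set V := ∑ x, M.allocProb (fun j => some (s j)) x * (v i (s i) x - Wf v M D i (s i)) with hV
  calc V - 2 * (L * r) = ∑ κ, φ κ (s i) * (V - 2 * (L * r)) := by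
        rw [← Finset.sum_mul, h1, one_mul]
    _ ≤ _ := by
        refine Finset.sum_le_sum fun κ _ => ?_
        by_cases hm : mass φ D i κ = 0
        · rw [hs i κ hm, hm]; simp
        · have e3 : tau φ D o i κ (s i) = some (s i) := by unfold tau; rw [if_neg hm]
          have e4 : mass φ D i κ * wt φ D i κ (s i) = φ κ (s i) := by
            unfold wt; rw [if_neg hm]; field_simp
          rw [← mul_assoc (mass φ D i κ), e4, e3, upd_self]
          by_cases hκ : φ κ (s i) = 0
          · simp [hκ]
          refine mul_le_mul_of_nonneg_left ?_ (h0 _ _)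
          have := h_lip φ c v M D hL hlc hv hbox hbic hpay i κ (s i) hb hκ _
            (M.allocProb_nonneg (fun j => some (s j))) (M.allocProb_sum_one _)
          linarith [(abs_le.1 this).2]

variable (E : Fin n → Measure (Fin m → ℝ)) [∀ i, IsProbabilityMeasure (E i)]
  (hEbox : ∀ i, suppBox H (E i))
  (hτ : ∀ i, ∑ κ, |mass φ E i κ - mass φ D i κ| ≤ τ)

include hH hL hEbox in
theorem robust_pay_integrable (i : Fin n) :
    Integrable (fun s => (robust φ v M D o hc h0 h1 hv hbox hbic hpay).pay (fun j => some (s j)) i)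
      (Measure.pi E) := by
  have e : (fun s : Fin n → Fin m → ℝ => (robust φ v M D o hc h0 h1 hv hbox hbic hpay).pay (fun j => some (s j)) i)
    = fun s => (∑ x, (robust φ v M D o hc h0 h1 hv hbox hbic hpay).allocProb (fun j => some (s j)) x
        * v i (s i) x) - Wf v M D i (s i) := by
    funext s
    rw [robust_pay, robust_alloc, hatPay_some]
  rw [e]
  refine Integrable.sub (integrable_finsetSum _ fun x _ => ?_)
    (eval_integrable E (lip_integrable hH hL.le (E i) (hEbox i) (Wf_abs v M D hv hbox hbic hpay i)))
  simp_rw [mul_comm (Mechanism.allocProb _ _ _)]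
  exact integrable_mul_alloc _ (f := fun s : Fin n → Fin m → ℝ => v i (s i) x)
      (eval_integrable E (i := i) (f := fun t => v i t x) (lip_integrable hH hL.le (E i) (hEbox i) fun t t' => hv i t t' x))
      meas_some_profile x

include hH hL hlc hEbox in
theorem rev_E (i : Fin n) :
    ∑ k : Fin n → K, (∏ j, mass φ E j (k j)) *
        (∑ x, Aprob φ D o M k x * (v i (c (k i)) x - Wf v M D i (c (k i)))) - 2 * (L * r) ≤
    ∫ s, (robust φ v M D o hc h0 h1 hv hbox hbic hpay).pay (fun j => some (s j)) i ∂(Measure.pi E) := by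
  set R : (Fin n → K) → ℝ := fun k =>
    ∑ x, Aprob φ D o M k x * (v i (c (k i)) x - Wf v M D i (c (k i))) with hR
  have ii : ∀ k, Integrable (fun s : Fin n → Fin m → ℝ => (∏ j, φ (k j) (s j)) * R k) (Measure.pi E) :=
    fun k => (phi_prod_integrable φ hc h0 h1 E k).mul_const _
  have e2 : ∑ k : Fin n → K, (∏ j, mass φ E j (k j)) * R k - 2 * (L * r) =
      ∫ s, (∑ k : Fin n → K, (∏ j, φ (k j) (s j)) * R k - 2 * (L * r)) ∂(Measure.pi E) := by
    rw [integral_sub (integrable_finsetSum _ fun k _ => ii k) (integrable_const _),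
      integral_finsetSum _ fun k _ => ii k]
    simp only [integral_const, probReal_univ, smul_eq_mul, one_mul, integral_mul_const]
    congr 1
    refine Finset.sum_congr rfl fun k _ => ?_
    rw [integral_fintype_prod_eq_prod (fun j => φ (k j))]
    rfl
  rw [e2]
  refine integral_mono_ae ((integrable_finsetSum _ fun k _ => ii k).sub (integrable_const _))
    (robust_pay_integrable φ v M D o hH hL hc h0 h1 hv hbox hbic hpay E hEbox i) ?_
  filter_upwards [ae_eval E (ae_box (E i) (hEbox i))] with s hb
  have hs1 : ∑ k : Fin n → K, ∏ j, φ (k j) (s j) = 1 := by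
    rw [← Fintype.prod_sum (fun (j : Fin n) κ => φ κ (s j))]; simp [h1]
  have e3 : (robust φ v M D o hc h0 h1 hv hbox hbic hpay).pay (fun j => some (s j)) i =
      ∑ k : Fin n → K, (∏ j, φ (k j) (s j)) *
        ∑ x, Aprob φ D o M k x * (v i (s i) x - Wf v M D i (s i)) := by
    rw [robust_pay, hatPay_some, hatAlloc_avg]
    simp_rw [mul_sub, Finset.sum_sub_distrib, ← Finset.sum_mul, Aprob_sum φ D o M hc h0 h1, one_mul,
      mul_sub, Finset.sum_sub_distrib, ← Finset.sum_mul, hs1, one_mul]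
  have e4 : ∑ k : Fin n → K, (∏ j, φ (k j) (s j)) * R k - 2 * (L * r) =
      ∑ k : Fin n → K, (∏ j, φ (k j) (s j)) * (R k - 2 * (L * r)) := by
    simp_rw [mul_sub, Finset.sum_sub_distrib, ← Finset.sum_mul, hs1, one_mul]
  change ∑ k : Fin n → K, (∏ j, φ (k j) (s j)) * R k - 2 * (L * r) ≤
    (robust φ v M D o hc h0 h1 hv hbox hbic hpay).pay (fun j => some (s j)) i
  rw [e3, e4]
  refine Finset.sum_le_sum fun k _ => ?_
  by_cases hκ : φ (k i) (s i) = 0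
  · rw [Finset.prod_eq_zero (Finset.mem_univ i) hκ]; simp
  refine mul_le_mul_of_nonneg_left ?_ (Finset.prod_nonneg fun j _ => h0 _ _)
  have := h_lip φ c v M D hL hlc hv hbox hbic hpay i (k i) (s i) hb hκ _
            (Aprob_nonneg φ D o M h0 k) (Aprob_sum φ D o M hc h0 h1 k)
  linarith [(abs_le.1 this).1]

include hH hL hlc hcb hv0 hvB hEbox hτ in
theorem robust_rev_one (i : Fin n) :
    ∫ s, M.pay (fun j => some (s j)) i ∂(Measure.pi D) - (4 * (L * r) + 2 * (m * L * H) * (n * τ)) ≤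
    ∫ s, (robust φ v M D o hc h0 h1 hv hbox hbic hpay).pay (fun j => some (s j)) i ∂(Measure.pi E) := by
  have a1 := rev_D φ c v M D o hH hL hc h0 h1 hlc hv hbox hbic hpay i
  have a2 := rev_E φ c v M D o hH hL hc h0 h1 hlc hv hbox hbic hpay E hEbox i
  have wd := weighted_diff (ι := Fin n) (κ := K) (mass φ E) (mass φ D) (mass_nonneg φ E h0)
    (mass_nonneg φ D h0) (mass_sum φ E hc h0 h1) (mass_sum φ D hc h0 h1) τ hτ
    (fun k => ∑ x, Aprob φ D o M k x * (v i (c (k i)) x - Wf v M D i (c (k i))))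
    (2 * (m * L * H)) (Wf v M D i 0) (by positivity) (by
      intro k
      have e : ∑ x, Aprob φ D o M k x * (v i (c (k i)) x - Wf v M D i (c (k i))) + Wf v M D i 0 =
          ∑ x, Aprob φ D o M k x * (v i (c (k i)) x - Wf v M D i (c (k i)) + Wf v M D i 0) := by
        simp_rw [mul_add, Finset.sum_add_distrib, ← Finset.sum_mul, Aprob_sum φ D o M hc h0 h1, one_mul]
      rw [e]
      refine avg_abs_le _ _ (Aprob_nonneg φ D o M h0 k) (Aprob_sum φ D o M hc h0 h1 k) fun x => ?_
      have b1 := hv0 i _ x (hcb (k i))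
      have b2 := hvB i _ x (hcb (k i))
      have b3 := abs_le.1 (Wf_abs v M D hv hbox hbic hpay i (c (k i)) 0)
      have b4 : L * ∑ j, |c (k i) j - (0 : Fin m → ℝ) j| ≤ L * (m * H) :=
        mul_le_mul_of_nonneg_left (l1_box (hcb (k i)) fun j => by simp [hH.le]) hL.le
      rw [abs_le]
      constructor <;> linarith [b3.1, b3.2])
  have wd2 := (abs_le.1 wd).1
  simp only [Fintype.card_fin] at wd2
  linarith

end revenue

end MultiItem

namespace MultiItem

/-- the mechanism that never allocates and never charges. -/
def nullMech (n m : ℕ) : Mechanism n m where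
  allocProb _ x := if x = emptyAlloc n m then 1 else 0
  pay _ _ := 0
  allocProb_nonneg b x := by split_ifs <;> norm_num
  allocProb_sum_one b := by simp
  optOut b _ := ⟨rfl, rfl⟩
  meas_allocProb x := measurable_const
  meas_pay i := measurable_const

theorem null_util {n m : ℕ} (v : Fin n → (Fin m → ℝ) → Alloc n m → ℝ) (i : Fin n) (t : Fin m → ℝ)
    (b : Fin n → Option (Fin m → ℝ)) : util v (nullMech n m) i t b = v i t (emptyAlloc n m) := by
  simp [util, nullMech]

theorem isBIC_mono {n m : ℕ} {η η' H : ℝ} {v : Fin n → (Fin m → ℝ) → Alloc n m → ℝ}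
    {M : Mechanism n m} {D : Fin n → Measure (Fin m → ℝ)} (h : IsBIC η H v M D) (hη : η ≤ η') :
    IsBIC η' H v M D := fun i t ht bid hbid => (h i t ht bid hbid).trans (by linarith)

/-- individual payments are integrable as soon as the total payment is. -/
theorem pay_integrable_of_sum {n m : ℕ} {H B : ℝ} (v : Fin n → (Fin m → ℝ) → Alloc n m → ℝ)
    (M : Mechanism n m) (D : Fin n → Measure (Fin m → ℝ)) [∀ i, IsProbabilityMeasure (D i)]
    (hv0 : ∀ i t x, (∀ j, t j ∈ Icc (0:ℝ) H) → 0 ≤ v i t x)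
    (hvB : ∀ i t x, (∀ j, t j ∈ Icc (0:ℝ) H) → v i t x ≤ B)
    (hbox : ∀ i, suppBox H (D i)) (hIR : IsIR H v M)
    (hs : Integrable (fun s => ∑ i, M.pay (fun j => some (s j)) i) (Measure.pi D)) (i : Fin n) :
    Integrable (fun s => M.pay (fun j => some (s j)) i) (Measure.pi D) := by
  have hall : ∀ᵐ s ∂(Measure.pi D), ∀ i j, s i j ∈ Icc (0:ℝ) H :=
    ae_all_iff.2 fun i => ae_eval D (ae_box (D i) (hbox i))
  have hmeas : Measurable fun s : Fin n → Fin m → ℝ => M.pay (fun j => some (s j)) i :=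
    (M.meas_pay i).comp meas_some_profile
  refine Integrable.mono' (g := fun s => |∑ i, M.pay (fun j => some (s j)) i| + (n + 1) * |B|)
    (hs.abs.add (integrable_const _)) hmeas.aestronglyMeasurable ?_
  filter_upwards [hall] with s hsb
  have hle : ∀ k, M.pay (fun j => some (s j)) k ≤ |B| := by
    intro k
    have h := hIR s hsb k
    unfold util at h
    have h2 := avg_abs_le _ (fun x => v k (s k) x) (M.allocProb_nonneg (fun j => some (s j)))
      (M.allocProb_sum_one _) (C := |B|) (fun x => by
        rw [abs_of_nonneg (hv0 k _ x (hsb k))]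
        exact (hvB k _ x (hsb k)).trans (le_abs_self _))
    linarith [(abs_le.1 h2).2]
  have h3 : ∑ k ∈ Finset.univ.erase i, M.pay (fun j => some (s j)) k ≤ n * |B| := by
    calc _ ≤ ∑ k ∈ Finset.univ.erase i, |B| := Finset.sum_le_sum fun k _ => hle k
      _ ≤ ∑ _k : Fin n, |B| := Finset.sum_le_sum_of_subset_of_nonneg (Finset.erase_subset _ _)
          fun _ _ _ => abs_nonneg _
      _ = n * |B| := by simp
  have h4 := Finset.add_sum_erase Finset.univ (fun k => M.pay (fun j => some (s j)) k) (Finset.mem_univ i)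
  have h5 := neg_abs_le (∑ i, M.pay (fun j => some (s j)) i)
  have h6 := abs_nonneg (∑ i, M.pay (fun j => some (s j)) i)
  have h7 := hle i
  have h8 : 0 ≤ (n:ℝ) * |B| := by positivity
  have h9 := abs_nonneg B
  rw [Real.norm_eq_abs, abs_le]
  constructor <;> linarith

end MultiItem

/-- Prokhorov robustness for multi-item auctions: there are absolute
constants `C₁`, `C₂` such that from any BIC (w.r.t. `D`) and IR mechanism `M` one can
construct a mechanism `M̂` (from `M` and `D` alone) that, for every product distribution
`D̂` with `‖Dᵢ − D̂ᵢ‖_P ≤ ε` for every `i`, is `κ`-BIC w.r.t. `D̂` and IR, where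
`κ = C₁(nmLHε + mL√(nHε))`, and satisfies `Rev_T(M̂, D̂) ≥ Rev(M, D) − C₂·n·κ`. -/
theorem stmt11 :
    ∃ C₁ C₂ : ℝ, 0 < C₁ ∧ 0 < C₂ ∧
      ∀ (n m : ℕ) (H L ε : ℝ), 0 < H → 0 < L → 0 < ε →
      ∀ v : Fin n → (Fin m → ℝ) → Alloc n m → ℝ,
        (∀ i t x, (∀ j, t j ∈ Icc (0:ℝ) H) → 0 ≤ v i t x) →
        (∀ i t x, (∀ j, t j ∈ Icc (0:ℝ) H) → v i t x ≤ m * L * H) →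
        (∀ i t t' x, |v i t x - v i t' x| ≤ L * ∑ j, |t j - t' j|) →
      ∀ D : Fin n → Measure (Fin m → ℝ),
        (∀ i, IsProbabilityMeasure (D i)) → (∀ i, suppBox H (D i)) →
      ∀ M : Mechanism n m, IsBIC 0 H v M D → IsIR H v M →
      ∃ Mhat : Mechanism n m,
        ∀ Dhat : Fin n → Measure (Fin m → ℝ),
          (∀ i, IsProbabilityMeasure (Dhat i)) →
          (∀ i, suppBox H (Dhat i)) →
          (∀ i, ProkhorovLe (D i) (Dhat i) ε) →
          IsBIC (C₁ * (n * m * L * H * ε + m * L * Real.sqrt (n * H * ε))) H v Mhat Dhat ∧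
          IsIR H v Mhat ∧
          RevT M D - C₂ * n * (C₁ * (n * m * L * H * ε + m * L * Real.sqrt (n * H * ε))) ≤
            RevT Mhat Dhat := by
  refine ⟨8, 2, by norm_num, by norm_num, ?_⟩
  intro n m H L ε hH hL hε v hv0 hvB hv D hD hbox M hbic hIR
  have hκ : 0 ≤ n * m * L * H * ε + m * L * Real.sqrt (n * H * ε) := by positivity
  rcases Nat.eq_zero_or_pos n with hn | hn
  · subst hn
    refine ⟨M, fun Dhat _ _ _ => ⟨fun i => i.elim0, fun t _ i => i.elim0, ?_⟩⟩
    simp [RevT]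
  rcases Nat.eq_zero_or_pos m with hm | hm
  · subst hm
    refine ⟨M, fun Dhat hDh _ _ => ?_⟩
    have : Dhat = D := by
      funext i
      ext A _
      have := hDh i
      have := hD i
      rcases Set.eq_empty_or_nonempty A with h | h
      · simp [h]
      · rw [Subsingleton.eq_univ_of_nonempty h]; simp
    subst this
    exact ⟨isBIC_mono hbic (by linarith), hIR, by simp⟩
  by_cases hs : Integrable (fun s => ∑ i, M.pay (fun j => some (s j)) i) (Measure.pi D)
  swap
  · refine ⟨nullMech n m, fun Dhat hDh _ _ => ⟨?_, ?_, ?_⟩⟩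
    · intro i t _ bid _
      unfold interim
      simp_rw [null_util]
      linarith
    · intro t ht i
      rw [null_util]
      exact hv0 i _ _ (ht i)
    · have e1 : RevT M D = 0 := integral_undef hs
      have e2 : RevT (nullMech n m) Dhat = 0 := by simp [RevT, nullMech]
      rw [e1, e2]
      have : 0 ≤ 2 * (n:ℝ) * (8 * (n * m * L * H * ε + m * L * Real.sqrt (n * H * ε))) := by
        positivity
      linarith
  have hpay := pay_integrable_of_sum v M D hv0 hvB hbox hIR hs
  have hn' : (0:ℝ) < n := by exact_mod_cast hn
  have hm' : (0:ℝ) < m := by exact_mod_cast hm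
  set δ := Real.sqrt (n * H * ε) with hδdef
  have hδ : 0 < δ := Real.sqrt_pos.2 (by positivity)
  have hδ2 : δ * δ = n * H * ε := Real.mul_self_sqrt (by positivity)
  obtain ⟨K, _, φ, c, hc, h0, h1, hcb, hloc, hlc, hl⟩ := pou m H δ hH hδ
  have hη : 0 < m * L * δ := by positivity
  choose o hog hon using fun (i : Fin n) (κ : K) => exists_near v M D i (c κ) hη
  refine ⟨robust φ v M D o hc h0 h1 hv hbox hbic hpay, fun E hE hEbox hP => ?_⟩
  have hτ : ∀ i, ∑ κ, |mass φ E i κ - mass φ D i κ| ≤ 2 * ε / δ + 2 * ε := fun i =>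
    signal_tv (D i) (E i) φ hc h0 h1 δ ε hδ hε hl (hP i)
  have hB : m * L * H * (n * (2 * ε / δ + 2 * ε)) = 2 * (m * L * δ) + 2 * (n * m * L * H * ε) := by
    have : n * H * ε / δ = δ := by rw [← hδ2]; field_simp
    calc _ = 2 * (m * L * (n * H * ε / δ)) + 2 * (n * m * L * H * ε) := by ring
      _ = _ := by rw [this]
  have hX : 0 ≤ n * m * L * H * ε := by positivity
  refine ⟨?_, robust_IR φ v M D o hc h0 h1 hv hv0 hbox hbic hpay, ?_⟩
  · refine isBIC_mono (robust_BIC φ c v M D o hH hL hη.le hc h0 h1 hloc hlc hv hv0 hvB hbox hbic hpay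
      hog (fun i κ => (hon i κ).le) E hEbox hτ) ?_
    rw [hB]
    nlinarith
  · have hone := robust_rev_one φ c v M D o hH hL hc h0 h1 hcb hlc hv hv0 hvB hbox hbic hpay E hEbox hτ
    unfold RevT
    rw [integral_finsetSum _ fun i _ => hpay i, integral_finsetSum _ fun i _ =>
      robust_pay_integrable φ v M D o hH hL hc h0 h1 hv hbox hbic hpay E hEbox i]
    have hsum := Finset.sum_le_sum fun i (_ : i ∈ Finset.univ) => hone i
    rw [Finset.sum_sub_distrib] at hsum
    refine le_trans ?_ hsum
    simp only [Finset.sum_const, Finset.card_univ, Fintype.card_fin, nsmul_eq_mul]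
    have h3 : 4 * (L * (2 * m * δ)) + 2 * (m * L * H) * (n * (2 * ε / δ + 2 * ε)) ≤
        2 * (8 * (n * m * L * H * ε + m * L * δ)) := by
      nlinarith
    have h4 := mul_le_mul_of_nonneg_left h3 hn'.le
    linarith
end
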